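/- Let c > 1 be an odd integer and let a be any integer. Then, as n → ∞, v(a,c;n) ~ (n^{1/4}/(2c))·p̄(n), i.e. the ratio of the two sides tends to 1. -/

import Mathlib

open Complex Real Filter Topology

noncomputable section

/-- An odd-balanced unimodal sequence, encoded as (left list `L`, peak `p`, right list `R`):
all parts positive, the peak `p` is even and strictly larger than all other parts,
the left side is weakly increasing and the right side weakly decreasing, repeated
(i.e. equal consecutive) parts are allowed only when they are odd, and the odd parts
before the peak are identical to the odd parts after the peak. -/
def IsOddBalanced (L : List ℕ) (p : ℕ) (R : List ℕ) : Prop :=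
  Even p ∧ 0 < p ∧ (∀ x ∈ L, 0 < x) ∧ (∀ x ∈ R, 0 < x) ∧
  L.Chain' (fun a b => a ≤ b ∧ (a = b → Odd a)) ∧
  R.Chain' (fun a b => b ≤ a ∧ (a = b → Odd a)) ∧
  (∀ x ∈ L, x < p) ∧ (∀ x ∈ R, x < p) ∧
  L.filter (fun x => x % 2 == 1) = R.reverse.filter (fun x => x % 2 == 1)

/-- `v(m,n)`: number of odd-balanced unimodal sequences of size `2n+2` and rank `m`. -/
def oddBalancedCount (m : ℤ) (n : ℕ) : ℕ :=
  Nat.card {x : List ℕ × ℕ × List ℕ //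
    IsOddBalanced x.1 x.2.1 x.2.2 ∧ x.1.sum + x.2.1 + x.2.2.sum = 2 * n + 2 ∧
    (x.2.2.length : ℤ) - (x.1.length : ℤ) = m}

/-- `v(a,c;n)`: number of odd-balanced unimodal sequences of size `2n+2`
whose rank is congruent to `a` modulo `c`. -/
def oddBalancedCountMod (a : ℤ) (c : ℕ) (n : ℕ) : ℕ :=
  Nat.card {x : List ℕ × ℕ × List ℕ //
    IsOddBalanced x.1 x.2.1 x.2.2 ∧ x.1.sum + x.2.1 + x.2.2.sum = 2 * n + 2 ∧
    (x.2.2.length : ℤ) - (x.1.length : ℤ) ≡ a [ZMOD (c : ℤ)]}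

/-- `v(n)`: total number of odd-balanced unimodal sequences of size `2n+2`. -/
def oddBalancedTotal (n : ℕ) : ℕ :=
  Nat.card {x : List ℕ × ℕ × List ℕ //
    IsOddBalanced x.1 x.2.1 x.2.2 ∧ x.1.sum + x.2.1 + x.2.2.sum = 2 * n + 2}

/-- Overpartition function `p̄(n)`: each partition of `n` is counted with
multiplicity `2^(number of distinct parts)` (the overlined parts), which matches the
generating function `∏ (1+qⁿ)/(1-qⁿ)`. -/
def overpartition (n : ℕ) : ℕ := ∑ p : n.Partition, 2 ^ p.parts.toFinset.card

/-! ### Part A: formal power series identities -/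
namespace OB
open PowerSeries

/-- The geometric series `1/(1-X^k)` for `k ≥ 1`. -/
def gInv (K : Type*) [CommRing K] (k : ℕ) : PowerSeries K :=
  PowerSeries.mk (fun n => if k ∣ n then 1 else 0)

lemma gInv_mul (K : Type*) [CommRing K] {k : ℕ} (hk : 0 < k) :
    (1 - (X : PowerSeries K) ^ k) * gInv K k = 1 := by
  ext n
  rw [sub_mul, one_mul, map_sub, coeff_X_pow_mul', gInv, coeff_mk, coeff_mk, coeff_one]
  rcases Nat.eq_zero_or_pos n with rfl | hn
  · simp [hk.ne']
  · by_cases h : k ≤ n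
    · simp [h, Nat.dvd_sub_self_right, hn.ne']
      by_cases h2 : k ∣ n
      · simp [h2]
      · have : n ≠ k := by rintro rfl; exact h2 dvd_rfl
        rw [if_neg h2, if_neg, sub_zero]
        rintro (h3 | h3)
        · exact h2 h3
        · omega
    · have : ¬ k ∣ n := fun h' => h (Nat.le_of_dvd hn h')
      simp [h, this, hn.ne']

section shanks
variable {R : Type*} [CommRing R] (q : R) (g : ℕ → R)

/-- Shanks finite product. -/
def shP (s n : ℕ) : R := ∏ k ∈ Finset.Ico s n, ((1 - q ^ (2 * k + 2)) * g k)

lemma shP_succ_right {s n : ℕ} (h : s ≤ n) :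
    shP q g s (n + 1) = shP q g s n * ((1 - q ^ (2 * n + 2)) * g n) := by
  rw [shP, shP, Finset.prod_Ico_succ_top h]

lemma shP_succ_left {s n : ℕ} (h : s < n) :
    shP q g s n = ((1 - q ^ (2 * s + 2)) * g s) * shP q g (s + 1) n := by
  rw [shP, shP, Finset.prod_eq_prod_Ico_succ_bot h]

lemma shanks_psi (hg : ∀ k, (1 - q ^ (2 * k + 1)) * g k = 1) (n : ℕ) :
    ∑ s ∈ Finset.range (n + 1), shP q g s n * q ^ (s * (2 * n + 1)) =
      ∑ s ∈ Finset.range (2 * n + 1), q ^ (s * (s + 1) / 2) := by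
  induction n with
  | zero => simp [shP]
  | succ n ih =>
    have key : ∀ m, m ≤ n + 1 → ∑ s ∈ Finset.range m,
        (shP q g s (n + 1) * q ^ (s * (2 * (n + 1) + 1)) - shP q g s n * q ^ (s * (2 * n + 1)))
        = if m ≤ n then shP q g m n * q ^ (m * (2 * n + 1)) * (1 - q ^ (2 * m)) * g n
          else q ^ ((n + 1) * (2 * n + 1)) := by
      intro m
      induction m with
      | zero => simp
      | succ m ihm =>
        intro hm
        have hmn : m ≤ n := by omega
        rw [Finset.sum_range_succ, ihm (by omega), if_pos hmn, shP_succ_right q g hmn]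
        have hgn := hg n
        split_ifs with h
        · rw [shP_succ_left q g (by omega : m < n)]
          have hgm := hg m
          linear_combination (q ^ (m * (2 * n + 1)) * ((1 - q ^ (2 * m + 2)) * g m) *
            shP q g (m + 1) n) * hgn + (g n * q ^ (2 * n + 1) * q ^ (m * (2 * n + 1)) *
            (1 - q ^ (2 * m + 2)) * shP q g (m + 1) n) * hgm
        · have : m = n := by omega
          subst this
          simp only [shP, Finset.Ico_self, Finset.prod_empty]
          linear_combination (q ^ (m * (2 * m + 1)) * (1 + q ^ (2 * m + 1))) * hgn
    have h1 := key (n + 1) le_rfl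
    rw [if_neg (by omega), Finset.sum_sub_distrib, ih] at h1
    rw [Finset.sum_range_succ, show 2 * (n + 1) + 1 = 2 * n + 1 + 1 + 1 by ring,
      Finset.sum_range_succ _ (2 * n + 1 + 1), Finset.sum_range_succ _ (2 * n + 1)]
    have e1 : (2 * n + 1) * (2 * n + 1 + 1) / 2 = (n + 1) * (2 * n + 1) := by
      rw [show (2 * n + 1) * (2 * n + 1 + 1) = ((n + 1) * (2 * n + 1)) * 2 by ring]; simp
    have e2 : (2 * n + 1 + 1) * (2 * n + 1 + 1 + 1) / 2 = (n + 1) * (2 * n + 1 + 1 + 1) := by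
      rw [show (2 * n + 1 + 1) * (2 * n + 1 + 1 + 1) = ((n + 1) * (2 * n + 1 + 1 + 1)) * 2 by ring]
      simp
    rw [e1, e2, ← h1]
    simp [shP]
    ring_nf

end shanks

/-- `∏_{j=1}^{n} (1+X^j)`. -/
def Dn (n : ℕ) : PowerSeries ℝ := ∏ j ∈ Finset.range n, (1 + X ^ (j + 1))

/-- `∏_{k<n} 1/(1-X^(2k+1))`. -/
def On (n : ℕ) : PowerSeries ℝ := ∏ k ∈ Finset.range n, gInv ℝ (2 * k + 1)

/-- `∏_{j=1}^{n} (1+X^j)/(1-X^j)`. -/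
def Pn (n : ℕ) : PowerSeries ℝ := ∏ j ∈ Finset.range n, ((1 + X ^ (j + 1)) * gInv ℝ (j + 1))

/-- `T_n`. -/
def Tn (n : ℕ) : PowerSeries ℝ := Dn n ^ 2 * On n
/-- `U_n`. -/
def Un (n : ℕ) : PowerSeries ℝ := Dn n ^ 2 * On (n + 1)
/-- partial sums with extra weight. -/
def VN (e N : ℕ) : PowerSeries ℝ := ∑ n ∈ Finset.range N, X ^ (e * n) * Un n

lemma Tn_eq (n : ℕ) : Tn n = shP (X : PowerSeries ℝ) (fun k => gInv ℝ (2 * k + 1)) 0 n * Pn n := by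
  rw [Tn, Dn, On, shP, Pn, ← Finset.prod_pow, ← Finset.prod_mul_distrib, Nat.Ico_zero_eq_range,
    ← Finset.prod_mul_distrib]
  refine Finset.prod_congr rfl fun j _ => ?_
  have h := gInv_mul ℝ (Nat.succ_pos j)
  simp only [Nat.succ_eq_add_one] at h
  have e : (X : PowerSeries ℝ) ^ (2 * j + 2) = (X ^ (j + 1)) ^ 2 := by ring
  rw [e]
  linear_combination (-(1 + (X : PowerSeries ℝ) ^ (j + 1)) ^ 2 * gInv ℝ (2 * j + 1)) * h

lemma Tn_zero : Tn 0 = 1 := by simp [Tn, Dn, On]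

lemma Tn_step (n : ℕ) : Tn (n + 1) - Tn n =
    2 * X * (X ^ (1 * n) * Un n) + (X + X ^ 2) * (X ^ (2 * n) * Un n) := by
  have h := gInv_mul ℝ (Nat.succ_pos (2 * n))
  rw [Tn, Tn, Un, Dn, Dn, On, On, Finset.prod_range_succ, Finset.prod_range_succ]
  simp only [Nat.succ_eq_add_one] at h
  linear_combination ((∏ x ∈ Finset.range n, (1 + (X : PowerSeries ℝ) ^ (x + 1))) ^ 2 *
      ∏ x ∈ Finset.range n, gInv ℝ (2 * x + 1)) * h

lemma Tn_step' (n : ℕ) : X ^ (1 * n) * Tn n =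
    X ^ (1 * n) * Un n - X * (X ^ (3 * n) * Un n) := by
  have h := gInv_mul ℝ (Nat.succ_pos (2 * n))
  rw [Tn, Un, On, On, Finset.prod_range_succ]
  simp only [Nat.succ_eq_add_one] at h
  linear_combination (-(X ^ n * Dn n ^ 2 * ∏ x ∈ Finset.range n, gInv ℝ (2 * x + 1))) * h

lemma tele1 (N : ℕ) : Tn N - 1 = 2 * X * VN 1 N + (X + X ^ 2) * VN 2 N := by
  rw [← Tn_zero, ← Finset.sum_range_sub, VN, VN, Finset.mul_sum, Finset.mul_sum,
    ← Finset.sum_add_distrib]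
  exact Finset.sum_congr rfl fun n _ => Tn_step n

lemma tele2 (N : ℕ) : X ^ N * Tn N - 1 = 2 * X ^ 2 * VN 2 N + (X ^ 2 + X ^ 3) * VN 3 N
    - (1 - X) * (VN 1 N - X * VN 3 N) := by
  have h0 : X ^ N * Tn N - 1 = X ^ N * Tn N - X ^ 0 * Tn 0 := by simp [Tn_zero]
  rw [h0, ← Finset.sum_range_sub (fun n => X ^ n * Tn n), VN, VN, VN]
  simp only [Finset.mul_sum, ← Finset.sum_sub_distrib, ← Finset.sum_add_distrib]
  refine Finset.sum_congr rfl fun n _ => ?_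
  have h1 := Tn_step n
  have h2 := Tn_step' n
  linear_combination X ^ (n + 1) * h1 - (1 - X) * h2

/-- nonnegative coefficients -/
def NN (f : PowerSeries ℝ) : Prop := ∀ n, 0 ≤ coeff n f

lemma NN.mul {f g : PowerSeries ℝ} (hf : NN f) (hg : NN g) : NN (f * g) := fun n => by
  rw [coeff_mul]; exact Finset.sum_nonneg fun _ _ => mul_nonneg (hf _) (hg _)
lemma NN.add {f g : PowerSeries ℝ} (hf : NN f) (hg : NN g) : NN (f + g) := fun n => by
  rw [map_add]; exact add_nonneg (hf _) (hg _)
lemma NN.X_pow (k : ℕ) : NN (X ^ k) := fun n => by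
  rw [coeff_X_pow]; split_ifs <;> norm_num
lemma NN.one : NN 1 := fun n => by rw [coeff_one]; split_ifs <;> norm_num
lemma NN.C {a : ℝ} (ha : 0 ≤ a) : NN (C a) := fun n => by
  rw [coeff_C]; split_ifs <;> simp [ha]
lemma NN.gInv (k : ℕ) : NN (gInv ℝ k) := fun n => by
  rw [OB.gInv, coeff_mk]; split_ifs <;> norm_num
lemma NN.prod {ι : Type*} (s : Finset ι) {f : ι → PowerSeries ℝ} (h : ∀ i ∈ s, NN (f i)) :
    NN (∏ i ∈ s, f i) := Finset.prod_induction f NN (fun _ _ => NN.mul) NN.one h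
lemma NN.sum {ι : Type*} (s : Finset ι) {f : ι → PowerSeries ℝ} (h : ∀ i ∈ s, NN (f i)) :
    NN (∑ i ∈ s, f i) := Finset.sum_induction f NN (fun _ _ => NN.add) (fun n => by simp) h
lemma NN.pow {f : PowerSeries ℝ} (h : NN f) (k : ℕ) : NN (f ^ k) := by
  simpa using NN.prod (Finset.range k) (f := fun _ => f) (fun _ _ => h)

lemma NN_Un (n : ℕ) : NN (Un n) :=
  ((NN.prod _ fun _ _ => NN.one.add (NN.X_pow _)).pow 2).mul (NN.prod _ fun _ _ => NN.gInv _)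

lemma NN_VN (e n : ℕ) : NN (VN e n) := NN.sum _ fun _ _ => (NN.X_pow _).mul (NN_Un _)

lemma NN_Pn (n : ℕ) : NN (Pn n) :=
  NN.prod _ fun _ _ => (NN.one.add (NN.X_pow _)).mul (NN.gInv _)

end OB

namespace OB
open PowerSeries

lemma C_two : (C 2 : PowerSeries ℝ) = 2 := map_ofNat (PowerSeries.C (R := ℝ)) 2

lemma one_add_mul_gInv {k : ℕ} (hk : 0 < k) :
    (1 + (X : PowerSeries ℝ) ^ k) * gInv ℝ k = 1 + X ^ k * (2 * gInv ℝ k) := by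
  have h := gInv_mul ℝ hk
  linear_combination h

lemma Pn_succ (N : ℕ) : Pn (N + 1) = Pn N + X ^ (N + 1) * (Pn N * (2 * gInv ℝ (N + 1))) := by
  rw [Pn, Finset.prod_range_succ, ← Pn, one_add_mul_gInv (by omega : 0 < N + 1)]
  ring

lemma Pn_mono (m N : ℕ) : coeff m (Pn N) ≤ coeff m (Pn (N + 1)) := by
  rw [Pn_succ, map_add, le_add_iff_nonneg_right]
  refine ((NN.X_pow _).mul ((NN_Pn _).mul (NN.mul ?_ (NN.gInv _)))) m
  have := NN.one.add NN.one
  rwa [one_add_one_eq_two] at this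

lemma Pn_stable {m N : ℕ} (h : m ≤ N) : coeff m (Pn N) = coeff m (Pn m) := by
  induction N, h using Nat.le_induction with
  | base => rfl
  | succ N h ih =>
    rw [Pn_succ, map_add, ih, coeff_X_pow_mul', if_neg (by omega), add_zero]

/-- the coefficients of the overpartition generating function -/
def pb (n : ℕ) : ℝ := coeff n (Pn n)

lemma pb_nonneg (n : ℕ) : 0 ≤ pb n := NN_Pn n n

lemma coeff_Pn_le (m N : ℕ) : coeff m (Pn N) ≤ pb m := by
  rcases le_total m N with h | h
  · rw [Pn_stable h, pb]
  · rw [pb]; exact monotone_nat_of_le_succ (Pn_mono m) h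

open scoped PowerSeries.WithPiTopology in
lemma overpartition_eq (n : ℕ) : (overpartition n : ℝ) = pb n := by
  have h := (Nat.Partition.hasProd_genFun (R := ℝ) (fun _ _ => (2 : ℝ))).tendsto_prod_nat
  have hfac : ∀ i : ℕ, (1 + ∑' j : ℕ, (2 : ℝ) • (X : PowerSeries ℝ) ^ ((i + 1) * (j + 1)))
      = (1 + X ^ (i + 1)) * gInv ℝ (i + 1) := by
    intro i
    rw [one_add_mul_gInv (Nat.succ_pos i)]
    congr 1
    ext d
    rw [(Nat.Partition.summable_genFun_term (fun _ _ => (2 : ℝ)) i).map_tsum _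
      (WithPiTopology.continuous_coeff _ _)]
    have : ∀ j : ℕ, coeff d ((2 : ℝ) • (X : PowerSeries ℝ) ^ ((i + 1) * (j + 1)))
        = if d = (i + 1) * (j + 1) then 2 else 0 := by
      intro j; rw [map_smul, coeff_X_pow]; split_ifs <;> simp
    simp_rw [this]
    rw [coeff_X_pow_mul', ← C_two]
    simp only [coeff_C_mul, gInv, coeff_mk]
    by_cases hd : i + 1 ∣ d ∧ d ≠ 0
    · obtain ⟨⟨j, rfl⟩, h0⟩ := hd
      have hj : j ≠ 0 := by rintro rfl; simp at h0
      obtain ⟨j, rfl⟩ := Nat.exists_eq_add_one_of_ne_zero hj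
      rw [tsum_eq_single j]
      · have h1 : (i + 1) * (j + 1) - (i + 1) = (i + 1) * j := by
          rw [Nat.mul_succ]; omega
        rw [if_pos rfl, if_pos (Nat.le_mul_of_pos_right _ (Nat.succ_pos j)), h1]
        simp
      · intro b hb
        rw [if_neg]
        intro h'
        have := Nat.eq_of_mul_eq_mul_left (Nat.succ_pos i) h'
        omega
    · have hz : ∀ j : ℕ, (if d = (i + 1) * (j + 1) then (2 : ℝ) else 0) = 0 := by
        intro j
        rw [if_neg]
        rintro rfl
        exact hd ⟨dvd_mul_right _ _, by positivity⟩
      simp_rw [hz]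
      rw [tsum_zero]
      · split_ifs with h1 h2
        · exfalso
          apply hd
          refine ⟨?_, by omega⟩
          have := Nat.dvd_add h2 (dvd_refl (i+1))
          rwa [Nat.sub_add_cancel h1] at this
        · simp
        · rfl
  simp_rw [hfac] at h
  have h2 := (WithPiTopology.tendsto_iff_coeff_tendsto _ _ _ _).mp h n
  have h3 : Tendsto (fun N => coeff n (Pn N)) atTop (𝓝 (pb n)) := by
    refine tendsto_const_nhds.congr' ?_
    filter_upwards [eventually_ge_atTop n] with N hN
    rw [Pn_stable hN, pb]
  have h4 := tendsto_nhds_unique h2 h3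
  rw [← h4, Nat.Partition.coeff_genFun, overpartition]
  push_cast
  refine Finset.sum_congr rfl fun p _ => ?_
  simp [Finsupp.prod]

/-- triangular convolution -/
def sC (n : ℕ) : ℝ := ∑ k ∈ Finset.range (n + 1),
  if k * (k + 1) / 2 ≤ n then pb (n - k * (k + 1) / 2) else 0

lemma le_tri (k : ℕ) : k ≤ k * (k + 1) / 2 := by
  rcases Nat.eq_zero_or_pos k with rfl | h
  · simp
  · rw [Nat.le_div_iff_mul_le (by norm_num)]; nlinarith

lemma coeff_Tn {m N : ℕ} (h : m ≤ N) : coeff m (Tn N) = sC m := by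
  have h1 := shanks_psi (X : PowerSeries ℝ) (fun k => gInv ℝ (2 * k + 1))
    (fun k => gInv_mul ℝ (Nat.succ_pos _)) N
  rw [Finset.sum_range_succ'] at h1
  simp only [zero_mul, pow_zero, mul_one] at h1
  have h2 : coeff m ((∑ k ∈ Finset.range N, shP (X : PowerSeries ℝ) (fun k => gInv ℝ (2 * k + 1))
      (k + 1) N * X ^ ((k + 1) * (2 * N + 1))) * Pn N) = 0 := by
    rw [Finset.sum_mul, map_sum]
    refine Finset.sum_eq_zero fun k _ => ?_
    rw [mul_assoc, mul_left_comm, coeff_X_pow_mul', if_neg]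
    nlinarith
  rw [Tn_eq, eq_sub_of_add_eq' h1, sub_mul, map_sub, h2, sub_zero, Finset.sum_mul, map_sum, sC]
  have h3 : Finset.range (m + 1) ⊆ Finset.range (2 * N + 1) :=
    Finset.range_subset_range.mpr (by omega)
  rw [← Finset.sum_subset h3]
  · refine Finset.sum_congr rfl fun k _ => ?_
    rw [coeff_X_pow_mul']
    split_ifs
    · rw [Pn_stable (by omega), pb]
    · rfl
  · intro k _ hk
    rw [coeff_X_pow_mul', if_neg]
    have := le_tri k
    simp at hk
    omega

/-- the total count, as a coefficient -/
def vt (n : ℕ) : ℝ := coeff n (VN 1 (n + 1))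

lemma VN_stable {e m N : ℕ} (he : 1 ≤ e) (h : m < N) : coeff m (VN e N) = coeff m (VN e (m + 1)) := by
  induction N, h using Nat.le_induction with
  | base => rfl
  | succ N h ih =>
    rw [VN, Finset.sum_range_succ, map_add, ← VN, ih, coeff_X_pow_mul', if_neg, add_zero]
    have : m + 1 ≤ N := h
    nlinarith

lemma vt_eq {m N : ℕ} (h : m < N) : coeff m (VN 1 N) = vt m := VN_stable le_rfl h

lemma sC_succ (m : ℕ) : sC (m + 2) = 2 * vt (m + 1) + coeff (m + 1) (VN 2 (m + 5))
    + coeff m (VN 2 (m + 5)) := by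
  have h := congrArg (coeff (m + 2)) (tele1 (m + 5))
  rw [map_sub, coeff_Tn (by omega), coeff_one, if_neg (by omega), sub_zero, map_add] at h
  rw [h, add_mul, map_add, mul_assoc, ← C_two, coeff_C_mul,
    coeff_succ_X_mul, coeff_succ_X_mul, vt_eq (by omega), coeff_X_pow_mul', if_pos (by omega)]
  simp only [Nat.add_sub_cancel]
  ring

lemma two_W_le (m : ℕ) : 2 * coeff m (VN 2 (m + 5)) ≤ vt (m + 2) - vt (m + 1) := by
  have h := congrArg (coeff (m + 2)) (tele2 (m + 5))
  have e : 2 * X ^ 2 * VN 2 (m + 5) + (X ^ 2 + X ^ 3) * VN 3 (m + 5)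
    - (1 - X) * (VN 1 (m + 5) - X * VN 3 (m + 5)) = C 2 * (X ^ 2 * VN 2 (m + 5)) +
      (X ^ 1 + X ^ 3) * VN 3 (m + 5) - VN 1 (m + 5) + X * VN 1 (m + 5) := by
    rw [C_two]; ring
  rw [e, map_sub, coeff_X_pow_mul', if_neg (by omega), coeff_one, if_neg (by omega), map_add,
    map_sub, map_add, coeff_C_mul, coeff_X_pow_mul', if_pos (by omega), coeff_succ_X_mul,
    vt_eq (by omega), vt_eq (by omega)] at h
  simp only [Nat.add_sub_cancel] at h
  have := (((NN.X_pow 1).add (NN.X_pow 3)).mul (NN_VN 3 (m + 5))) (m + 2)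
  linarith

lemma two_vt_le (m : ℕ) : 2 * vt (m + 1) ≤ sC (m + 2) := by
  rw [sC_succ]
  have h1 := NN_VN 2 (m + 5) (m + 1)
  have h2 := NN_VN 2 (m + 5) m
  linarith

lemma sC_le (m : ℕ) : sC (m + 2) ≤ 3 / 2 * vt (m + 1) + sC (m + 4) / 4 := by
  have h1 := two_W_le m
  have h2 := two_W_le (m + 1)
  rw [VN_stable (by norm_num) (by omega)] at h2 h1
  have h3 := sC_succ m
  rw [VN_stable (by norm_num) (by omega), VN_stable (m := m) (by norm_num) (by omega)] at h3
  have h4 := two_vt_le (m + 2)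
  simp only [add_assoc] at *
  norm_num at *
  linarith

end OB

namespace OB
open PowerSeries

/-! ### Part C: evaluation of power series and the theta identity -/

section Ev
variable {K : Type*} [RCLike K]

/-- `f` converges absolutely at `x` with value `v`. -/
def Ev (f : PowerSeries ℝ) (x v : K) : Prop :=
  Summable (fun n => ‖((coeff n f : ℝ) : K) * x ^ n‖) ∧ ∑' n, ((coeff n f : ℝ) : K) * x ^ n = v

lemma Ev.hasSum {f : PowerSeries ℝ} {x v : K} (h : Ev f x v) :
    HasSum (fun n => ((coeff n f : ℝ) : K) * x ^ n) v := by
  have := h.1.of_norm.hasSum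
  rwa [h.2] at this

lemma Ev.add {f g : PowerSeries ℝ} {x v w : K} (hf : Ev f x v) (hg : Ev g x w) :
    Ev (f + g) x (v + w) := by
  have e : ∀ n, ((coeff n (f + g) : ℝ) : K) * x ^ n =
      ((coeff n f : ℝ) : K) * x ^ n + ((coeff n g : ℝ) : K) * x ^ n := by
    intro n; rw [map_add]; push_cast; ring
  constructor
  · simp_rw [e]
    exact Summable.of_nonneg_of_le (fun _ => norm_nonneg _) (fun _ => norm_add_le _ _)
      (hf.1.add hg.1)
  · simp_rw [e]
    exact (hf.hasSum.add hg.hasSum).tsum_eq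

lemma Ev.mul {f g : PowerSeries ℝ} {x v w : K} (hf : Ev f x v) (hg : Ev g x w) :
    Ev (f * g) x (v * w) := by
  have e : ∀ n, ((coeff n (f * g) : ℝ) : K) * x ^ n =
      ∑ kl ∈ Finset.HasAntidiagonal.antidiagonal n, (((coeff kl.1 f : ℝ) : K) * x ^ kl.1) *
        (((coeff kl.2 g : ℝ) : K) * x ^ kl.2) := by
    intro n
    rw [coeff_mul]
    push_cast
    rw [Finset.sum_mul]
    refine Finset.sum_congr rfl fun kl hkl => ?_
    rw [← Finset.HasAntidiagonal.mem_antidiagonal.mp hkl, pow_add]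
    ring
  constructor
  · simp_rw [e]
    exact summable_norm_sum_mul_antidiagonal_of_summable_norm
      (f := fun n => ((coeff n f : ℝ) : K) * x ^ n) (g := fun n => ((coeff n g : ℝ) : K) * x ^ n)
      hf.1 hg.1
  · simp_rw [e]
    rw [← hf.2, ← hg.2]
    exact (tsum_mul_tsum_eq_tsum_sum_antidiagonal_of_summable_norm
      (f := fun n => ((coeff n f : ℝ) : K) * x ^ n) (g := fun n => ((coeff n g : ℝ) : K) * x ^ n)
      hf.1 hg.1).symm

lemma Ev.C_mul_X_pow (a : ℝ) (k : ℕ) (x : K) : Ev (C a * X ^ k) x ((a : K) * x ^ k) := by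
  have hz : ∀ n, n ≠ k → ((coeff n (C a * X ^ k : PowerSeries ℝ) : ℝ) : K) * x ^ n = 0 := by
    intro n hn
    rw [coeff_C_mul, coeff_X_pow, if_neg hn]; simp
  constructor
  · refine (hasSum_single k fun n hn => ?_).summable
    rw [hz n hn, norm_zero]
  · rw [tsum_eq_single k hz]
    simp

lemma Ev.X_pow (k : ℕ) (x : K) : Ev (X ^ k) x (x ^ k) := by
  simpa using Ev.C_mul_X_pow 1 k x

lemma Ev.one (x : K) : Ev 1 x 1 := by simpa using Ev.X_pow 0 x

lemma Ev.prod {ι : Type*} (s : Finset ι) {f : ι → PowerSeries ℝ} {x : K} {v : ι → K}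
    (h : ∀ i ∈ s, Ev (f i) x (v i)) : Ev (∏ i ∈ s, f i) x (∏ i ∈ s, v i) := by
  classical
  induction s using Finset.induction_on with
  | empty => simpa using Ev.one x
  | insert a s ha ih =>
    rw [Finset.prod_insert ha, Finset.prod_insert ha]
    exact (h _ (Finset.mem_insert_self _ _)).mul
      (ih fun i hi => h i (Finset.mem_insert_of_mem hi))

lemma Ev.zero (x : K) : Ev 0 x 0 := by
  simpa using Ev.C_mul_X_pow 0 0 x

lemma Ev.sum {ι : Type*} (s : Finset ι) {f : ι → PowerSeries ℝ} {x : K} {v : ι → K}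
    (h : ∀ i ∈ s, Ev (f i) x (v i)) : Ev (∑ i ∈ s, f i) x (∑ i ∈ s, v i) := by
  classical
  induction s using Finset.induction_on with
  | empty => simpa using Ev.zero x
  | insert a s ha ih =>
    rw [Finset.sum_insert ha, Finset.sum_insert ha]
    exact (h _ (Finset.mem_insert_self _ _)).add
      (ih fun i hi => h i (Finset.mem_insert_of_mem hi))

lemma one_sub_pow_ne {x : K} (hx : ‖x‖ < 1) {k : ℕ} (hk : 0 < k) : 1 - x ^ k ≠ 0 := by
  intro h
  have h1 : ‖x ^ k‖ = 1 := by rw [← sub_eq_zero.mp h]; simp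
  rw [norm_pow] at h1
  have := pow_lt_one₀ (norm_nonneg x) hx hk.ne'
  linarith

lemma one_add_pow_ne {x : K} (hx : ‖x‖ < 1) {k : ℕ} (hk : 0 < k) : 1 + x ^ k ≠ 0 := by
  intro h
  have h1 : ‖x ^ k‖ = 1 := by rw [eq_neg_of_add_eq_zero_right h]; simp
  rw [norm_pow] at h1
  have := pow_lt_one₀ (norm_nonneg x) hx hk.ne'
  linarith

lemma Ev.gInv {x : K} (hx : ‖x‖ < 1) {k : ℕ} (hk : 0 < k) : Ev (gInv ℝ k) x (1 - x ^ k)⁻¹ := by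
  have hs : Summable (fun n => ‖((coeff n (OB.gInv ℝ k) : ℝ) : K) * x ^ n‖) := by
    refine Summable.of_nonneg_of_le (fun _ => norm_nonneg _) (fun n => ?_)
      (summable_geometric_of_lt_one (norm_nonneg x) hx)
    rw [OB.gInv, coeff_mk, norm_mul, norm_pow]
    split_ifs
    · simp
    · simp
  obtain ⟨v, hv⟩ : ∃ v, Ev (OB.gInv ℝ k) x v := ⟨_, hs, rfl⟩
  have h1 : Ev (1 + C (-1) * X ^ k) x (1 + ((-1 : ℝ) : K) * x ^ k) :=
    (Ev.one x).add (Ev.C_mul_X_pow (-1) k x)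
  have h2 := h1.mul hv
  have e : (1 + C (-1) * X ^ k : PowerSeries ℝ) * OB.gInv ℝ k = 1 := by
    have := gInv_mul ℝ hk
    rw [sub_eq_add_neg] at this
    simpa using this
  rw [e] at h2
  have h3 := h2.2.symm.trans (Ev.one x).2
  have h4 := one_sub_pow_ne hx hk
  have : v = (1 - x ^ k)⁻¹ := by
    apply eq_inv_of_mul_eq_one_right
    push_cast at h3
    linear_combination h3
  rwa [← this]

lemma Ev.Pn {x : K} (hx : ‖x‖ < 1) (N : ℕ) :
    Ev (Pn N) x (∏ j ∈ Finset.range N, ((1 + x ^ (j + 1)) * (1 - x ^ (j + 1))⁻¹)) :=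
  Ev.prod _ fun j _ => ((Ev.one x).add (Ev.X_pow _ x)).mul (Ev.gInv hx (Nat.succ_pos j))

end Ev

/-- the coefficient bound -/
lemma Ev.coeff_le {f : PowerSeries ℝ} {r v : ℝ} (hr : 0 ≤ r) (hf : NN f) (h : Ev f r v) (n : ℕ) :
    coeff n f * r ^ n ≤ v := by
  have := h.hasSum
  exact le_hasSum this n fun m _ => mul_nonneg (hf m) (pow_nonneg hr m)

lemma Ev.sum_le {f : PowerSeries ℝ} {r v : ℝ} (hr : 0 ≤ r) (hf : NN f) (h : Ev f r v)
    (s : Finset ℕ) : ∑ n ∈ s, coeff n f * r ^ n ≤ v := by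
  have := h.hasSum
  exact sum_le_hasSum s (fun m _ => mul_nonneg (hf m) (pow_nonneg hr m)) this

lemma prod_bound {r : ℝ} (hr0 : 0 ≤ r) (hr1 : r < 1) (s : Finset ℕ) :
    ∏ j ∈ s, ((1 + r ^ (j + 1)) * (1 - r ^ (j + 1))⁻¹) ≤ rexp (2 / (1 - r) ^ 2) := by
  have h1 : ∀ j ∈ s, (1 + r ^ (j + 1)) * (1 - r ^ (j + 1))⁻¹ ≤ rexp (2 / (1 - r) * r ^ j) := by
    intro j _
    have a0 : 0 ≤ r ^ (j + 1) := pow_nonneg hr0 _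
    have a1 : r ^ (j + 1) ≤ r ^ j := pow_le_pow_of_le_one hr0 hr1.le (Nat.le_succ j)
    have a2 : r ^ (j + 1) ≤ r := by
      simpa using pow_le_pow_of_le_one hr0 hr1.le (Nat.succ_le_succ (Nat.zero_le j))
    have a3 : 0 < 1 - r ^ (j + 1) := by linarith
    have a4 : 0 < 1 - r := by linarith
    have e : (1 + r ^ (j + 1)) * (1 - r ^ (j + 1))⁻¹ = 2 / (1 - r ^ (j + 1)) * r ^ (j + 1) + 1 := by
      field_simp; ring
    rw [e]
    refine (Real.add_one_le_exp _).trans (Real.exp_le_exp.mpr ?_)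
    gcongr
  refine (Finset.prod_le_prod (fun j _ => ?_) h1).trans ?_
  · have a0 : 0 ≤ r ^ (j + 1) := pow_nonneg hr0 _
    have a2 : r ^ (j + 1) ≤ r := by
      simpa using pow_le_pow_of_le_one hr0 hr1.le (Nat.succ_le_succ (Nat.zero_le j))
    have a3 : 0 < 1 - r ^ (j + 1) := by linarith
    positivity
  · rw [← Real.exp_sum, ← Finset.mul_sum]
    apply Real.exp_le_exp.mpr
    have a4 : 0 < 1 - r := by linarith
    have := sum_le_hasSum s (fun j _ => pow_nonneg hr0 j) (hasSum_geometric_of_lt_one hr0 hr1)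
    calc 2 / (1 - r) * ∑ i ∈ s, r ^ i ≤ 2 / (1 - r) * (1 - r)⁻¹ := by gcongr
      _ = _ := by field_simp

lemma summable_pb {r : ℝ} (hr0 : 0 ≤ r) (hr1 : r < 1) : Summable (fun n => pb n * r ^ n) := by
  refine summable_of_sum_range_le (c := rexp (2 / (1 - r) ^ 2))
    (fun n => mul_nonneg (pb_nonneg n) (pow_nonneg hr0 n)) fun N => ?_
  have h : ∑ i ∈ Finset.range N, pb i * r ^ i = ∑ i ∈ Finset.range N, coeff i (Pn N) * r ^ i := by
    refine Finset.sum_congr rfl fun i hi => ?_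
    rw [Pn_stable (Finset.mem_range.mp hi).le, pb]
  rw [h]
  exact (Ev.sum_le hr0 (NN_Pn N) (Ev.Pn (by rwa [Real.norm_of_nonneg hr0]) N) _).trans
    (prod_bound hr0 hr1 _)

/-- the overpartition generating function -/
def PB (q : ℂ) : ℂ := ∑' n, (pb n : ℂ) * q ^ n

/-- real version -/
def PBr (r : ℝ) : ℝ := ∑' n, pb n * r ^ n

lemma tendsto_PB {K : Type*} [RCLike K] {q : K} (hq : ‖q‖ < 1) :
    Tendsto (fun N => ∏ j ∈ Finset.range N, ((1 + q ^ (j + 1)) * (1 - q ^ (j + 1))⁻¹)) atTop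
      (𝓝 (∑' n, (pb n : K) * q ^ n)) := by
  have h : ∀ N, ∏ j ∈ Finset.range N, ((1 + q ^ (j + 1)) * (1 - q ^ (j + 1))⁻¹) =
      ∑' n, ((coeff n (Pn N) : ℝ) : K) * q ^ n := fun N => (Ev.Pn hq N).2.symm
  simp_rw [h]
  refine tendsto_tsum_of_dominated_convergence (summable_pb (norm_nonneg q) hq) (fun n => ?_) ?_
  · refine tendsto_const_nhds.congr' ?_
    filter_upwards [eventually_ge_atTop n] with N hN
    rw [Pn_stable hN, pb]
  · refine Eventually.of_forall fun N n => ?_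
    rw [norm_mul, norm_pow]
    gcongr
    rw [RCLike.norm_ofReal, abs_of_nonneg (NN_Pn N n)]
    exact coeff_Pn_le n N

lemma PBr_ge_one {r : ℝ} (hr0 : 0 ≤ r) (hr1 : r < 1) (N : ℕ) :
    ∏ j ∈ Finset.range N, ((1 + r ^ (j + 1)) * (1 - r ^ (j + 1))⁻¹) ≤ PBr r := by
  rw [← (Ev.Pn (K := ℝ) (x := r) (by rwa [Real.norm_of_nonneg hr0]) N).2]
  have h1 := (Ev.Pn (K := ℝ) (x := r) (by rwa [Real.norm_of_nonneg hr0]) N).1.of_norm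
  refine h1.tsum_le_tsum (fun n => ?_) (summable_pb hr0 hr1)
  exact mul_le_mul_of_nonneg_right (coeff_Pn_le n N) (pow_nonneg hr0 n)

/-! #### the theta identity -/

section shanks
variable (q : ℂ) (h : ℕ → ℂ)

/-- finite product -/
def shQ (s n : ℕ) : ℂ := ∏ k ∈ Finset.Ico s n, ((1 - q ^ (k + 1)) * h (k + 1))

lemma shQ_succ_right {s n : ℕ} (hs : s ≤ n) :
    shQ q h s (n + 1) = shQ q h s n * ((1 - q ^ (n + 1)) * h (n + 1)) := by
  rw [shQ, shQ, Finset.prod_Ico_succ_top hs]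

lemma shQ_succ_left {s n : ℕ} (hs : s < n) :
    shQ q h s n = ((1 - q ^ (s + 1)) * h (s + 1)) * shQ q h (s + 1) n := by
  rw [shQ, shQ, Finset.prod_eq_prod_Ico_succ_bot hs]

lemma shanks_theta (hh : ∀ k, (1 + q ^ k) * h k = 1) (n : ℕ) :
    ∑ s ∈ Finset.range (n + 1), (-1) ^ s * 2 * h s * q ^ (s * (n + 1)) * shQ q h s n =
      1 + 2 * ∑ s ∈ Finset.range n, (-1) ^ (s + 1) * q ^ ((s + 1) ^ 2) := by
  have h0 := hh 0
  induction n with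
  | zero => simp [shQ]; simp at h0; linear_combination h0
  | succ n ih =>
    have key : ∀ m, m ≤ n + 1 → ∑ s ∈ Finset.range m,
        ((-1) ^ s * 2 * h s * q ^ (s * (n + 1 + 1)) * shQ q h s (n + 1)
          - (-1) ^ s * 2 * h s * q ^ (s * (n + 1)) * shQ q h s n)
        = if m ≤ n then
            (-1) ^ m * 2 * h m * q ^ (m * (n + 1)) * shQ q h m n * h (n + 1) * (1 - q ^ m)
          else (-1) ^ (n + 1) * 2 * q ^ ((n + 1) ^ 2) * h (n + 1) := by
      intro m
      induction m with
      | zero => simp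
      | succ m ihm =>
        intro hm
        have hmn : m ≤ n := by omega
        rw [Finset.sum_range_succ, ihm (by omega), if_pos hmn, shQ_succ_right q h hmn]
        have hn := hh (n + 1)
        have hm' := hh m
        split_ifs with h'
        · rw [shQ_succ_left q h (by omega : m < n)]
          have hm1 := hh (m + 1)
          linear_combination (2 * (-1) ^ m * q ^ (m * (n + 1)) * ((1 - q ^ (m + 1)) * h (m + 1)) *
            shQ q h (m + 1) n * h m) * hn - (2 * (-1) ^ m * q ^ (m * (n + 1)) *
            ((1 - q ^ (m + 1)) * h (m + 1)) * shQ q h (m + 1) n * h (n + 1) * q ^ (n + 1)) * hm'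
        · have : m = n := by omega
          subst this
          simp only [shQ, Finset.Ico_self, Finset.prod_empty]
          linear_combination (2 * (-1) ^ m * q ^ (m * (m + 1)) * h m) * hn
            - (2 * (-1) ^ m * q ^ (m * (m + 1)) * h (m + 1) * q ^ (m + 1)) * hm'
    have h1 := key (n + 1) le_rfl
    rw [if_neg (by omega), Finset.sum_sub_distrib, ih] at h1
    rw [Finset.sum_range_succ, Finset.sum_range_succ (fun s => (-1) ^ (s + 1) * q ^ ((s + 1) ^ 2)) n]
    simp only [shQ, Finset.Ico_self, Finset.prod_empty] at h1 ⊢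
    have hn := hh (n + 1)
    linear_combination h1 + (2 * (-1) ^ (n + 1) * q ^ ((n + 1) ^ 2)) * hn

end shanks

lemma norm_fac_le {q : ℂ} (hq : ‖q‖ < 1) (k : ℕ) :
    ‖(1 - q ^ (k + 1)) * (1 + q ^ (k + 1))⁻¹‖ ≤
      (1 + ‖q‖ ^ (k + 1)) * (1 - ‖q‖ ^ (k + 1))⁻¹ := by
  have h1 : ‖q‖ ^ (k + 1) < 1 := pow_lt_one₀ (norm_nonneg q) hq (Nat.succ_ne_zero k)
  rw [norm_mul, norm_inv]
  have h2 : ‖1 - q ^ (k + 1)‖ ≤ 1 + ‖q‖ ^ (k + 1) := by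
    refine (norm_sub_le _ _).trans ?_
    rw [norm_one, norm_pow]
  have h3 : 1 - ‖q‖ ^ (k + 1) ≤ ‖1 + q ^ (k + 1)‖ := by
    have := norm_sub_le_norm_add (1 : ℂ) (q ^ (k + 1))
    rwa [norm_one, norm_pow] at this
  have h4 : 0 < 1 - ‖q‖ ^ (k + 1) := by linarith
  gcongr

/-- `PB q * θ₄(q) = 1` -/
lemma PB_mul_theta {q : ℂ} (hq : ‖q‖ < 1) {θ : ℂ}
    (hθ : Tendsto (fun n => 1 + 2 * ∑ s ∈ Finset.range n, (-1) ^ (s + 1) * q ^ ((s + 1) ^ 2))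
      atTop (𝓝 θ)) : PB q * θ = 1 := by
  set h : ℕ → ℂ := fun k => (1 + q ^ k)⁻¹ with hh
  have hh1 : ∀ k, (1 + q ^ k) * h k = 1 := by
    intro k
    apply mul_inv_cancel₀
    rcases Nat.eq_zero_or_pos k with rfl | hk
    · norm_num
    · exact one_add_pow_ne hq hk
  have hr0 := norm_nonneg q
  set B := rexp (2 / (1 - ‖q‖) ^ 2)
  have hQ : ∀ s n, ‖shQ q h s n‖ ≤ B := by
    intro s n
    rw [shQ, norm_prod]
    exact (Finset.prod_le_prod (fun _ _ => norm_nonneg _) fun k _ => norm_fac_le hq k).trans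
      (prod_bound hr0 hq _)
  have hlim : Tendsto (fun n => shQ q h 0 n) atTop (𝓝 θ) := by
    have e : ∀ n, shQ q h 0 n = (1 + 2 * ∑ s ∈ Finset.range n, (-1) ^ (s + 1) * q ^ ((s + 1) ^ 2))
        - ∑ s ∈ Finset.range n, (-1) ^ (s + 1) * 2 * h (s + 1) * q ^ ((s + 1) * (n + 1)) *
          shQ q h (s + 1) n := by
      intro n
      rw [← shanks_theta q h hh1, Finset.sum_range_succ']
      simp [hh]
      norm_num
    simp_rw [e]
    rw [← sub_zero θ]
    refine hθ.sub ?_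
    have hb : ∀ n, ‖∑ s ∈ Finset.range n, (-1) ^ (s + 1) * 2 * h (s + 1) *
        q ^ ((s + 1) * (n + 1)) * shQ q h (s + 1) n‖ ≤
        (2 * (1 - ‖q‖)⁻¹ * B) * (n * ‖q‖ ^ n) := by
      intro n
      refine (norm_sum_le _ _).trans ?_
      have : ∀ s ∈ Finset.range n, ‖(-1) ^ (s + 1) * 2 * h (s + 1) *
          q ^ ((s + 1) * (n + 1)) * shQ q h (s + 1) n‖ ≤ 2 * (1 - ‖q‖)⁻¹ * B * ‖q‖ ^ n := by
        intro s _
        rw [norm_mul, norm_mul, norm_mul, norm_mul, norm_pow, norm_neg, norm_one, one_pow, norm_pow]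
        have a1 : ‖h (s + 1)‖ ≤ (1 - ‖q‖)⁻¹ := by
          rw [hh, norm_inv]
          have := norm_sub_le_norm_add (1 : ℂ) (q ^ (s + 1))
          rw [norm_one, norm_pow] at this
          have a2 : ‖q‖ ^ (s + 1) ≤ ‖q‖ := by
            simpa using pow_le_pow_of_le_one hr0 hq.le (Nat.succ_le_succ (Nat.zero_le s))
          have a4 : 0 < 1 - ‖q‖ := by linarith
          apply inv_anti₀ a4
          linarith
        have a3 : ‖q‖ ^ ((s + 1) * (n + 1)) ≤ ‖q‖ ^ n :=
          pow_le_pow_of_le_one hr0 hq.le (by nlinarith)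
        have a4 : 0 < 1 - ‖q‖ := by linarith
        calc 1 * ‖(2 : ℂ)‖ * ‖h (s + 1)‖ * ‖q‖ ^ ((s + 1) * (n + 1)) * ‖shQ q h (s + 1) n‖
            ≤ 1 * ‖(2 : ℂ)‖ * (1 - ‖q‖)⁻¹ * ‖q‖ ^ n * B := by
              have := hQ (s + 1) n
              gcongr
          _ = _ := by simp; ring
      refine (Finset.sum_le_sum this).trans ?_
      rw [Finset.sum_const, Finset.card_range, nsmul_eq_mul]
      apply le_of_eq; ring
    refine squeeze_zero_norm hb ?_
    have := (tendsto_self_mul_const_pow_of_lt_one hr0 hq).const_mul (2 * (1 - ‖q‖)⁻¹ * B)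
    simpa using this
  have h2 := (tendsto_PB hq).mul hlim
  refine tendsto_nhds_unique h2 (tendsto_const_nhds.congr fun n => ?_)
  rw [shQ, Nat.Ico_zero_eq_range, ← Finset.prod_mul_distrib]
  symm
  refine Finset.prod_eq_one fun j _ => ?_
  have h3 := one_sub_pow_ne hq (Nat.succ_pos j)
  have h4 := one_add_pow_ne hq (Nat.succ_pos j)
  simp only [Nat.succ_eq_add_one] at h3 h4
  rw [hh]
  field_simp

end OB

namespace OB
open PowerSeries

/-! ### Part D: circle method -/

/-- transformed theta function -/
def GG (z : ℂ) : ℂ := ∑' n : ℤ, cexp (-(π ^ 2 / z) * ((n : ℂ) ^ 2 - n))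

lemma pi_C_ne : (π : ℂ) ≠ 0 := by exact_mod_cast Real.pi_ne_zero

lemma ne_zero_of_re {z : ℂ} (hz : 0 < z.re) : z ≠ 0 := by
  rintro rfl; simp at hz

lemma theta_term (z : ℂ) (n : ℤ) :
    jacobiTheta₂_term n (1 / 2) (I * z / π) = (-1) ^ n * cexp (-z) ^ (n ^ 2) := by
  have hpi := pi_C_ne
  rw [jacobiTheta₂_term, ← Complex.exp_int_mul]
  have e : (2 * π * I * n * (1 / 2) + π * I * n ^ 2 * (I * z / π) : ℂ) =
      n * (π * I) + ((n ^ 2 : ℤ) : ℂ) * (-z) := by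
    push_cast
    field_simp
    linear_combination ((n : ℂ) ^ 2 * z) * I_sq
  rw [e, Complex.exp_add, Complex.exp_int_mul (π * I), Complex.exp_pi_mul_I]

lemma im_tau {z : ℂ} (hz : 0 < z.re) : 0 < (I * z / π).im := by
  have : (I * z / π).im = z.re / π := by
    rw [Complex.div_ofReal_im]; simp
  rw [this]; exact div_pos hz Real.pi_pos

lemma theta_tendsto {z : ℂ} (hz : 0 < z.re) :
    Tendsto (fun n => 1 + 2 * ∑ s ∈ Finset.range n, (-1) ^ (s + 1) * cexp (-z) ^ ((s + 1) ^ 2))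
      atTop (𝓝 (jacobiTheta₂ (1 / 2) (I * z / π))) := by
  have h := (hasSum_jacobiTheta₂_term (1 / 2) (im_tau hz)).nat_add_neg.tendsto_sum_nat
  have h2 := (h.comp (tendsto_add_atTop_nat 1)).sub_const (jacobiTheta₂_term 0 (1 / 2) (I * z / π))
  rw [add_sub_cancel_right] at h2
  refine h2.congr fun n => ?_
  simp only [Function.comp, theta_term]
  rw [Finset.sum_range_succ', Finset.mul_sum]
  have : ∀ s : ℕ, (-1 : ℂ) ^ ((s + 1 : ℕ) : ℤ) * cexp (-z) ^ (((s + 1 : ℕ) : ℤ) ^ 2) +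
      (-1) ^ (-((s + 1 : ℕ) : ℤ)) * cexp (-z) ^ ((-((s + 1 : ℕ) : ℤ)) ^ 2) =
      2 * ((-1) ^ (s + 1) * cexp (-z) ^ ((s + 1) ^ 2)) := by
    intro s
    have e1 : ((s + 1 : ℕ) : ℤ) ^ 2 = (((s + 1) ^ 2 : ℕ) : ℤ) := by push_cast; ring
    rw [neg_sq, e1, zpow_natCast, zpow_natCast, zpow_neg, zpow_natCast, ← inv_pow]
    norm_num
    ring
  simp_rw [this]
  simp
  ring

lemma theta_eq {z : ℂ} (hz : 0 < z.re) :
    PB (cexp (-z)) * GG z = (z / π) ^ (1 / 2 : ℂ) * cexp (π ^ 2 / (4 * z)) := by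
  have hq : ‖cexp (-z)‖ < 1 := by
    rw [Complex.norm_exp]; simpa using hz
  have h := PB_mul_theta hq (theta_tendsto hz)
  have hz0 := ne_zero_of_re hz
  have hpi := pi_C_ne
  have hI := I_ne_zero
  rw [jacobiTheta₂_functional_equation] at h
  have e1 : -I * (I * z / π) = z / π := by
    field_simp; linear_combination (-1 : ℂ) * I_sq
  have e2 : -π * I * (1 / 2) ^ 2 / (I * z / π) = -(π ^ 2 / (4 * z)) := by
    field_simp; norm_num
  have e3 : jacobiTheta₂ (1 / 2 / (I * z / π)) (-1 / (I * z / π)) = GG z := by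
    rw [jacobiTheta₂, GG]
    refine tsum_congr fun n => ?_
    rw [jacobiTheta₂_term]
    congr 1
    field_simp
    ring
  rw [e1, e2, e3] at h
  have hc : (z / π) ^ (1 / 2 : ℂ) ≠ 0 := by
    rw [Ne, Complex.cpow_eq_zero_iff]
    push Not
    intro h0
    exact absurd h0 (div_ne_zero hz0 hpi)
  rw [Complex.exp_neg (π ^ 2 / (4 * z))] at h
  have he := Complex.exp_ne_zero (π ^ 2 / (4 * z))
  generalize cexp (π ^ 2 / (4 * z)) = E at *
  generalize (z / π) ^ (1 / 2 : ℂ) = F at *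
  field_simp at h
  linear_combination h

lemma norm_GG_term (z : ℂ) (n : ℤ) :
    ‖cexp (-(π ^ 2 / z) * ((n : ℂ) ^ 2 - n))‖ =
      rexp (-((π ^ 2 / z : ℂ).re) * ((n : ℝ) ^ 2 - n)) := by
  have e : -(π ^ 2 / z : ℂ) * ((n : ℂ) ^ 2 - n) = ((((n : ℝ) ^ 2 - n : ℝ)) : ℂ) * (-(π ^ 2 / z : ℂ)) := by
    push_cast; ring
  rw [Complex.norm_exp, e, Complex.re_ofReal_mul, Complex.neg_re]
  ring_nf

lemma summable_gauss : Summable (fun n : ℤ => rexp (-((n : ℝ) ^ 2 - n - 1))) := by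
  have h := ((summable_jacobiTheta₂_term_iff (-I / (2 * π)) (I / π)).mpr (by
    rw [Complex.div_ofReal_im]; simp; exact Real.pi_pos)).norm
  refine (h.mul_left (rexp 1)).congr fun n => ?_
  rw [jacobiTheta₂_term, Complex.norm_exp, ← Real.exp_add]
  congr 1
  have hpi := pi_C_ne
  have e : (2 * π * I * n * (-I / (2 * π)) + π * I * n ^ 2 * (I / π) : ℂ) =
     (((n : ℝ) - (n : ℝ) ^ 2 : ℝ) : ℂ) := by
    push_cast
    field_simp
    linear_combination ((n : ℂ) ^ 2 - n) * I_sq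
  rw [e, Complex.ofReal_re]
  ring

/-- the constant in the bound -/
def C0 : ℝ := ∑' n : ℤ, rexp (-((n : ℝ) ^ 2 - n - 1))

lemma GG_bound {z : ℂ} (hz : 1 ≤ (π ^ 2 / z : ℂ).re) :
    ‖GG z - 2‖ ≤ C0 * rexp (-(π ^ 2 / z : ℂ).re) := by
  set a := (π ^ 2 / z : ℂ).re with ha
  have hcase : ∀ n : ℤ, n ≠ 0 → n ≠ 1 → (0 : ℝ) ≤ (n : ℝ) ^ 2 - n - 1 := by
    intro n h0 h1
    have : (0 : ℤ) ≤ n ^ 2 - n - 1 := by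
      rcases lt_or_gt_of_ne h0 with h | h
      · nlinarith
      · have : 2 ≤ n := by omega
        nlinarith
    exact_mod_cast this
  have hle : ∀ n : ℤ, n ≠ 0 → n ≠ 1 → rexp (-a * ((n : ℝ) ^ 2 - n)) ≤
      rexp (-((n : ℝ) ^ 2 - n - 1)) * rexp (-a) := by
    intro n h0 h1
    rw [← Real.exp_add]
    apply Real.exp_le_exp.mpr
    nlinarith [hcase n h0 h1]
  have hsum : Summable (fun n : ℤ => cexp (-(π ^ 2 / z) * ((n : ℂ) ^ 2 - n))) := by
    refine (summable_gauss.mul_right (rexp (-a))).of_norm_bounded_eventually ?_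
    have : ∀ᶠ n : ℤ in cofinite, n ∉ ({0, 1} : Set ℤ) := (Set.toFinite _).compl_mem_cofinite
    filter_upwards [this] with n hn
    simp at hn
    rw [norm_GG_term]
    exact hle n hn.1 hn.2
  have h2 : HasSum (fun n : ℤ => if n = 0 ∨ n = 1 then (1 : ℂ) else 0) 2 := by
    have := hasSum_sum_of_ne_finset_zero (L := SummationFilter.unconditional ℤ) (s := ({0, 1} : Finset ℤ))
      (f := fun n : ℤ => if n = 0 ∨ n = 1 then (1 : ℂ) else 0) (by
        intro b hb; simp at hb; simp [hb])
    rw [Finset.sum_pair (by norm_num)] at this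
    norm_num at this
    simpa [one_add_one_eq_two] using this
  have h3 := hsum.hasSum.sub h2
  have h4 := tsum_of_norm_bounded
    (summable_gauss.mul_right (rexp (-a))).hasSum
    (f := fun n : ℤ => cexp (-(π ^ 2 / z) * ((n : ℂ) ^ 2 - n)) - if n = 0 ∨ n = 1 then (1 : ℂ) else 0)
    (by
      intro n
      by_cases h : n = 0 ∨ n = 1
      · rw [if_pos h]
        rcases h with rfl | rfl
        · simp; positivity
        · simp; positivity
      · rw [if_neg h, sub_zero, norm_GG_term]
        push Not at h
        exact hle n h.1 h.2)
  rw [h3.tsum_eq, tsum_mul_right] at h4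
  exact h4

/-- Fourier coefficients -/
lemma pb_integral {t : ℝ} (ht : 0 < t) (m : ℕ) :
    ∫ θ in (-π)..π, PB (cexp (-(t - I * θ))) * cexp (-(I * m * θ)) =
      ((2 * π * (pb m * rexp (-t) ^ m) : ℝ) : ℂ) := by
  have hr1 : rexp (-t) < 1 := by simpa using ht
  have hr0 := (Real.exp_pos (-t)).le
  have hn : ∀ θ : ℝ, ‖cexp (-(t - I * θ))‖ = rexp (-t) := by
    intro θ; rw [Complex.norm_exp]; simp
  have e1 : ∀ k : ℕ, ∀ θ : ℝ, (pb k : ℂ) * cexp (-(t - I * θ)) ^ k * cexp (-(I * m * θ)) =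
      (pb k * rexp (-t) ^ k : ℝ) * cexp ((I * ((k : ℂ) - m)) * θ) := by
    intro k θ
    push_cast
    rw [← Complex.exp_nat_mul, ← Complex.exp_nat_mul, mul_assoc, mul_assoc, ← Complex.exp_add,
      mul_assoc, ← Complex.exp_add]
    congr 2
    ring
  have hterm : ∀ k : ℕ, ∫ θ in (-π)..π, (pb k : ℂ) * cexp (-(t - I * θ)) ^ k * cexp (-(I * m * θ)) =
      if k = m then ((2 * π * (pb m * rexp (-t) ^ m) : ℝ) : ℂ) else 0 := by
    intro k
    simp_rw [e1]
    rw [intervalIntegral.integral_const_mul]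
    split_ifs with h
    · subst h
      simp
      ring
    · have hc : I * ((k : ℂ) - m) ≠ 0 := by
        refine mul_ne_zero I_ne_zero (sub_ne_zero.mpr ?_)
        exact_mod_cast h
      rw [integral_exp_mul_complex hc]
      have : cexp (I * ((k : ℂ) - m) * (π : ℝ)) = cexp (I * ((k : ℂ) - m) * ((-π : ℝ) : ℂ)) := by
        rw [Complex.exp_eq_exp_iff_exists_int]
        refine ⟨(k : ℤ) - m, ?_⟩
        push_cast; ring
      rw [this, sub_self, zero_div, mul_zero]
  have hs := intervalIntegral.hasSum_integral_of_dominated_convergence (a := -π) (b := π)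
    (μ := MeasureTheory.volume)
    (F := fun k : ℕ => fun θ : ℝ => (pb k : ℂ) * cexp (-(t - I * θ)) ^ k * cexp (-(I * m * θ)))
    (f := fun θ : ℝ => PB (cexp (-(t - I * θ))) * cexp (-(I * m * θ)))
    (fun k _ => pb k * rexp (-t) ^ k)
    (fun k => by
      apply Continuous.aestronglyMeasurable
      fun_prop)
    (fun k => by
      refine Eventually.of_forall fun θ _ => ?_
      rw [norm_mul, norm_mul, norm_pow, hn, Complex.norm_exp, Complex.norm_real,
        Real.norm_of_nonneg (pb_nonneg k)]
      simp)
    (Eventually.of_forall fun θ _ => summable_pb hr0 hr1)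
    (by simp)
    (by
      refine Eventually.of_forall fun θ _ => ?_
      refine HasSum.mul_right _ ?_
      apply Summable.hasSum
      refine (summable_pb hr0 hr1).of_norm_bounded fun k => ?_
      rw [norm_mul, norm_pow, hn, Complex.norm_real, Real.norm_of_nonneg (pb_nonneg k)])
  simp_rw [hterm] at hs
  rw [hs.unique (hasSum_ite_eq m _)]

lemma continuous_PB_arc {t : ℝ} (ht : 0 < t) :
    Continuous (fun θ : ℝ => PB (cexp (-(t - I * θ)))) := by
  have hr1 : rexp (-t) < 1 := by simpa using ht
  have hr0 := (Real.exp_pos (-t)).le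
  refine continuous_tsum (fun k => by fun_prop) (summable_pb hr0 hr1) fun k θ => ?_
  rw [norm_mul, norm_pow, Complex.norm_exp, Complex.norm_real, Real.norm_of_nonneg (pb_nonneg k)]
  simp

end OB

namespace OB
open PowerSeries

/-- smallness condition for `t` -/
def Good (t : ℝ) : Prop := 0 < t ∧ t ≤ 1 / 2 ∧ C0 * rexp (-(π ^ 2 / (2 * t))) ≤ 1

lemma tendsto_exp_neg_div {c : ℝ} (hc : 0 < c) :
    Tendsto (fun t : ℝ => rexp (-(c / t))) (𝓝[>] 0) (𝓝 0) := by
  have : Tendsto (fun t : ℝ => c / t) (𝓝[>] 0) atTop := by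
    simp_rw [div_eq_mul_inv]
    exact tendsto_inv_nhdsGT_zero.const_mul_atTop hc
  exact Real.tendsto_exp_neg_atTop_nhds_zero.comp this

lemma eventually_good : ∀ᶠ t : ℝ in 𝓝[>] 0, Good t := by
  have h1 : ∀ᶠ t : ℝ in 𝓝[>] 0, 0 < t := self_mem_nhdsWithin
  have h2 : ∀ᶠ t : ℝ in 𝓝[>] 0, t ≤ 1 / 2 :=
    nhdsWithin_le_nhds (Iic_mem_nhds (by norm_num))
  have h3 := (tendsto_exp_neg_div (c := π ^ 2 / 2) (by positivity)).const_mul C0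
  rw [mul_zero] at h3
  filter_upwards [h1, h2, h3.eventually (Iic_mem_nhds one_pos)] with t a b c
  refine ⟨a, b, ?_⟩
  rwa [div_div] at c

lemma C0_nonneg : 0 ≤ C0 := tsum_nonneg fun _ => (Real.exp_pos _).le

lemma Good.norm_GG {t : ℝ} (ht : Good t) {z : ℂ} (hz : π ^ 2 / (2 * t) ≤ (π ^ 2 / z : ℂ).re) :
    1 ≤ ‖GG z‖ ∧ ‖GG z - 2‖ ≤ C0 * rexp (-(π ^ 2 / (2 * t))) := by
  obtain ⟨h0, h1, h2⟩ := ht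
  have h3 : 1 ≤ π ^ 2 / (2 * t) := by
    rw [le_div_iff₀ (by positivity)]
    nlinarith [Real.pi_gt_three]
  have h4 := GG_bound (h3.trans hz)
  have h5 : C0 * rexp (-(π ^ 2 / z : ℂ).re) ≤ C0 * rexp (-(π ^ 2 / (2 * t))) := by
    have := C0_nonneg
    gcongr
  refine ⟨?_, h4.trans h5⟩
  have h6 : ‖(2 : ℂ)‖ ≤ ‖GG z‖ + ‖GG z - 2‖ := by
    have := norm_sub_le (GG z) (GG z - 2)
    simpa using this
  rw [Complex.norm_two] at h6
  linarith

lemma PB_real (t : ℝ) : PB (cexp (-(t : ℂ))) = (PBr (rexp (-t)) : ℂ) := by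
  rw [PB, PBr]
  push_cast
  rfl

lemma PBr_nonneg {r : ℝ} (hr : 0 ≤ r) : 0 ≤ PBr r :=
  tsum_nonneg fun n => mul_nonneg (pb_nonneg n) (pow_nonneg hr n)

lemma Good.PBr_le {t : ℝ} (ht : Good t) : PBr (rexp (-t)) ≤ √t * rexp (π ^ 2 / (4 * t)) := by
  have h0 := ht.1
  have h1 := theta_eq (z := (t : ℂ)) (by simpa using h0)
  have h2 := ht.norm_GG (z := (t : ℂ)) (by
    rw [show (π ^ 2 / t : ℂ) = ((π ^ 2 / t : ℝ) : ℂ) by push_cast; rfl, Complex.ofReal_re]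
    gcongr
    linarith)
  have h3 := congrArg norm h1
  rw [norm_mul, PB_real, Complex.norm_real, Real.norm_of_nonneg (PBr_nonneg (Real.exp_pos _).le),
    norm_mul, show (π ^ 2 / (4 * t) : ℂ) = ((π ^ 2 / (4 * t) : ℝ) : ℂ) by push_cast; rfl,
    Complex.norm_exp_ofReal] at h3
  have h4 : ‖((t : ℂ) / π) ^ (1 / 2 : ℂ)‖ ≤ √t := by
    rw [show ((t : ℂ) / π) = ((t / π : ℝ) : ℂ) by push_cast; rfl,
      show (1 / 2 : ℂ) = ((1 / 2 : ℝ) : ℂ) by push_cast; rfl,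
      ← Complex.ofReal_cpow (by positivity), Complex.norm_real, ← Real.sqrt_eq_rpow,
      Real.norm_of_nonneg (Real.sqrt_nonneg _)]
    apply Real.sqrt_le_sqrt
    apply div_le_self h0.le
    linarith [Real.pi_gt_three]
  calc PBr (rexp (-t)) = PBr (rexp (-t)) * 1 := by ring
    _ ≤ PBr (rexp (-t)) * ‖GG t‖ :=
        mul_le_mul_of_nonneg_left h2.1 (PBr_nonneg (Real.exp_pos _).le)
    _ = _ := h3
    _ ≤ _ := by gcongr

lemma norm_one_add_le {x : ℂ} (hx : ‖x‖ ≤ 1) :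
    ‖1 + x‖ ≤ (1 + ‖x‖) * rexp (-((‖x‖ - x.re) / 4)) := by
  have h1 : ‖1 + x‖ ^ 2 = (1 + ‖x‖) ^ 2 - 2 * (‖x‖ - x.re) := by
    have e1 := Complex.sq_norm (1 + x)
    have e2 := Complex.sq_norm x
    rw [Complex.normSq_apply] at e1 e2
    simp at e1
    nlinarith
  set δ := ‖x‖ - x.re with hδ
  have hδ0 : 0 ≤ δ := sub_nonneg.mpr (Complex.re_le_norm x)
  have hn := norm_nonneg x
  have h2 : ‖1 + x‖ ^ 2 ≤ ((1 + ‖x‖) * rexp (-(δ / 4))) ^ 2 := by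
    rw [h1, mul_pow, ← Real.exp_nat_mul]
    have h3 := Real.add_one_le_exp (((2 : ℕ) : ℝ) * -(δ / 4))
    have h4 : (1 + ‖x‖) ^ 2 * (((2 : ℕ) : ℝ) * -(δ / 4) + 1) ≤
      (1 + ‖x‖) ^ 2 * rexp (((2 : ℕ) : ℝ) * -(δ / 4)) := by gcongr
    refine le_trans ?_ h4
    push_cast
    have h5 : 0 ≤ 4 - (1 + ‖x‖) ^ 2 := by nlinarith
    nlinarith [mul_nonneg hδ0 h5]
  exact (abs_le_of_sq_le_sq' h2 (by positivity)).2

lemma norm_fac_le2 {q : ℂ} (hq : ‖q‖ < 1) (k : ℕ) :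
    ‖(1 + q ^ (k + 1)) * (1 - q ^ (k + 1))⁻¹‖ ≤
      ((1 + ‖q‖ ^ (k + 1)) * (1 - ‖q‖ ^ (k + 1))⁻¹) *
        rexp (-((‖q‖ ^ (k + 1) - (q ^ (k + 1)).re) / 4)) := by
  have h1 : ‖q‖ ^ (k + 1) < 1 := pow_lt_one₀ (norm_nonneg q) hq (Nat.succ_ne_zero k)
  rw [norm_mul, norm_inv]
  have h2 := norm_one_add_le (x := q ^ (k + 1)) (by rw [norm_pow]; exact h1.le)
  rw [norm_pow] at h2
  have h3 : 1 - ‖q‖ ^ (k + 1) ≤ ‖1 - q ^ (k + 1)‖ := by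
    have := norm_sub_norm_le (1 : ℂ) (q ^ (k + 1))
    rwa [norm_one, norm_pow] at this
  have h4 : 0 < 1 - ‖q‖ ^ (k + 1) := by linarith
  calc _ ≤ ((1 + ‖q‖ ^ (k + 1)) * rexp (-((‖q‖ ^ (k + 1) - (q ^ (k + 1)).re) / 4))) *
      (1 - ‖q‖ ^ (k + 1))⁻¹ := by gcongr
    _ = _ := by ring

lemma norm_PB_le {q : ℂ} (hq : ‖q‖ < 1) :
    ‖PB q‖ ≤ PBr ‖q‖ * rexp (-(((1 - ‖q‖)⁻¹ - ((1 - q)⁻¹).re) / 4)) := by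
  have h1 := (tendsto_PB hq).norm
  have h2 := tendsto_PB (K := ℝ) (q := ‖q‖) (by simpa using hq)
  have hs1 := ((hasSum_geometric_of_lt_one (norm_nonneg q) hq).mul_left ‖q‖)
  have hs2 := Complex.hasSum_re ((hasSum_geometric_of_norm_lt_one hq).mul_left q)
  have hs := (hs1.sub hs2).tendsto_sum_nat
  have h3 := h2.mul ((Real.continuous_exp.tendsto _).comp ((hs.div_const 4).neg))
  have e : ‖q‖ * (1 - ‖q‖)⁻¹ - (q * (1 - q)⁻¹).re = (1 - ‖q‖)⁻¹ - ((1 - q)⁻¹).re := by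
    have a1 : (1 - ‖q‖) ≠ 0 := by linarith
    have a2 : 1 - q ≠ 0 := by simpa using one_sub_pow_ne hq one_pos
    have e1 : ‖q‖ * (1 - ‖q‖)⁻¹ = (1 - ‖q‖)⁻¹ - 1 := by field_simp; ring
    have e2 : q * (1 - q)⁻¹ = (1 - q)⁻¹ - 1 := by field_simp; ring
    rw [e1, e2, Complex.sub_re, Complex.one_re]; ring
  rw [e] at h3
  refine le_of_tendsto_of_tendsto' h1 h3 fun N => ?_
  rw [norm_prod]
  simp only [Function.comp]
  have e2 : rexp (-((∑ i ∈ Finset.range N, (‖q‖ * ‖q‖ ^ i - (q * q ^ i).re)) / 4)) =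
      ∏ i ∈ Finset.range N, rexp (-((‖q‖ ^ (i + 1) - (q ^ (i + 1)).re) / 4)) := by
    rw [← Real.exp_sum, Finset.sum_neg_distrib, ← Finset.sum_div]
    simp_rw [pow_succ']
  rw [e2, ← Finset.prod_mul_distrib]
  exact Finset.prod_le_prod (fun _ _ => norm_nonneg _) fun k _ => norm_fac_le2 hq k

lemma norm_arc (t θ : ℝ) : ‖cexp (-(t - I * θ))‖ = rexp (-t) := by
  rw [Complex.norm_exp]; simp

lemma minor_arc {t θ : ℝ} (ht : Good t) (h1 : t ≤ |θ|) (h2 : |θ| ≤ π) :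
    ‖PB (cexp (-(t - I * θ)))‖ ≤ √t * rexp (π ^ 2 / (4 * t)) * rexp (-(1 / 50 / t)) := by
  have h0 := ht.1
  have h12 := ht.2.1
  set q := cexp (-(t - I * θ)) with hq
  set r := rexp (-t) with hr
  have hqr : ‖q‖ = r := norm_arc t θ
  have hr1 : r < 1 := by simpa [hr] using h0
  have hrt : 1 - t ≤ r := by
    have := Real.add_one_le_exp (-t); linarith
  have hr2 : 1 / 2 ≤ r := by linarith
  have h3 := norm_PB_le (q := q) (by rw [hqr]; exact hr1)
  rw [hqr] at h3
  refine h3.trans ?_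
  refine mul_le_mul ht.PBr_le (Real.exp_le_exp.mpr ?_) (Real.exp_pos _).le (by positivity)
  rw [neg_le_neg_iff]
  have hsq : ‖1 - q‖ ^ 2 = (1 - r) ^ 2 + 2 * r * (1 - Real.cos θ) := by
    have hqe : q = ((r * Real.cos θ : ℝ) : ℂ) + ((r * Real.sin θ : ℝ) : ℂ) * I := by
      rw [hq, show (-(t - I * θ) : ℂ) = ((-t : ℝ) : ℂ) + θ * I by push_cast; ring,
        Complex.exp_add, Complex.exp_mul_I, hr]
      push_cast
      ring
    rw [Complex.sq_norm, Complex.normSq_apply, hqe]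
    generalize hc : r * Real.cos θ = c
    generalize hs : r * Real.sin θ = s
    simp
    rw [← hc, ← hs]
    linear_combination r ^ 2 * (Real.sin_sq_add_cos_sq θ)
  have hcos := Real.cos_le_one_sub_mul_cos_sq h2
  have hpi : π ^ 2 < 10 := by nlinarith [Real.pi_lt_d2, Real.pi_gt_three]
  have hθ2 : (1 - r) ^ 2 ≤ θ ^ 2 := by
    rw [← sq_abs θ]
    exact pow_le_pow_left₀ (by linarith) (by linarith) 2
  have hpi5 : 1 / 5 ≤ 2 / π ^ 2 := by
    rw [div_le_div_iff₀ (by norm_num) (by positivity)]; linarith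
  have h4 : (1.09 * (1 - r)) ^ 2 ≤ ‖1 - q‖ ^ 2 := by
    rw [hsq]
    have a1 : 1 / 5 * (1 - r) ^ 2 ≤ 1 - Real.cos θ := by
      have : 1 / 5 * (1 - r) ^ 2 ≤ 2 / π ^ 2 * θ ^ 2 := by gcongr
      linarith
    have a2 : 1 * (1 / 5 * (1 - r) ^ 2) ≤ 2 * r * (1 - Real.cos θ) := by
      gcongr
      linarith
    nlinarith
  have h5 : 1.09 * (1 - r) ≤ ‖1 - q‖ := (abs_le_of_sq_le_sq' h4 (norm_nonneg _)).2
  have h6 : ((1 - q)⁻¹).re ≤ (1.09 * (1 - r))⁻¹ := by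
    refine (Complex.re_le_norm _).trans ?_
    rw [norm_inv]
    exact inv_anti₀ (by linarith) h5
  have h7 : t⁻¹ ≤ (1 - r)⁻¹ := inv_anti₀ (by linarith) (by linarith)
  rw [mul_inv] at h6
  have h8 : (0 : ℝ) ≤ (1 - r)⁻¹ := inv_nonneg.mpr (by linarith)
  rw [div_eq_mul_inv]
  norm_num at h6 ⊢
  linarith

end OB

namespace OB
open PowerSeries MeasureTheory

/-- the integrand on the circle -/
def Ph (t : ℝ) (m : ℕ) (θ : ℝ) : ℂ := PB (cexp (-(t - I * θ))) * cexp (-(I * m * θ))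

/-- the rescaled major arc -/
def KK (t : ℝ) (m : ℕ) : ℝ → ℂ := Set.indicator (Set.Ioc (-(1 / √t)) (1 / √t))
  (fun s => ((rexp (-(π ^ 2 / (4 * t))) / √t : ℝ) : ℂ) * Ph t m (t * √t * s))

lemma continuous_Ph {t : ℝ} (ht : 0 < t) (m : ℕ) : Continuous (Ph t m) :=
  (continuous_PB_arc ht).mul (by fun_prop)

lemma re_one_sub (u : ℝ) : (1 - I * u : ℂ).re = 1 := by simp

lemma inv_re (u : ℝ) : ((1 - I * u : ℂ)⁻¹).re = 1 / (1 + u ^ 2) := by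
  rw [Complex.inv_re, Complex.normSq_apply]
  simp
  ring

lemma z_eq {t : ℝ} (s : ℝ) :
    ((t : ℂ) - I * ((t * √t * s : ℝ) : ℂ)) = t * (1 - I * ((√t * s : ℝ) : ℂ)) := by
  push_cast; ring

lemma cpow_split {t : ℝ} (ht : 0 < t) (u : ℝ) :
    ((t : ℂ) * (1 - I * u) / π) ^ (1 / 2 : ℂ) = (√t : ℂ) * ((1 - I * u) / π) ^ (1 / 2 : ℂ) := by
  have hne : (1 - I * u : ℂ) / π ≠ 0 :=
    div_ne_zero (ne_zero_of_re (by rw [re_one_sub]; norm_num)) pi_C_ne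
  have ht' : (t : ℂ) ≠ 0 := by exact_mod_cast ht.ne'
  rw [mul_div_assoc, Complex.cpow_def_of_ne_zero (mul_ne_zero ht' hne),
    Complex.cpow_def_of_ne_zero hne, Complex.log_ofReal_mul ht hne, add_mul, Complex.exp_add]
  congr 1
  rw [Real.sqrt_eq_rpow, Complex.ofReal_cpow ht.le, Complex.cpow_def_of_ne_zero ht',
    Complex.ofReal_log ht.le]
  push_cast
  rfl

lemma KK_formula {t : ℝ} (ht : Good t) (m : ℕ) {s : ℝ}
    (hs : s ∈ Set.Ioc (-(1 / √t)) (1 / √t)) :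
    KK t m s * GG (t * (1 - I * ((√t * s : ℝ) : ℂ))) =
      ((1 - I * ((√t * s : ℝ) : ℂ)) / π) ^ (1 / 2 : ℂ) *
      cexp (-(((π ^ 2 / 4 * s ^ 2 : ℝ)) : ℂ) * (1 - I * ((√t * s : ℝ) : ℂ))⁻¹) *
      cexp (I * (((π ^ 2 / (4 * t ^ 2) - m) * (t * √t) : ℝ) : ℂ) * s) := by
  have h0 := ht.1
  rw [KK, Set.indicator_of_mem hs, Ph, z_eq]
  set u : ℝ := √t * s with hu
  have hre : 0 < (t * (1 - I * u) : ℂ).re := by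
    rw [Complex.re_ofReal_mul, re_one_sub]; linarith
  have h1 := theta_eq hre
  rw [cpow_split h0] at h1
  have hσ : 0 < √t := Real.sqrt_pos.mpr h0
  have hne : (1 - I * u : ℂ) ≠ 0 := ne_zero_of_re (by rw [re_one_sub]; norm_num)
  have hσ' : ((√t : ℝ) : ℂ) ≠ 0 := by exact_mod_cast hσ.ne'
  have hexp : cexp (π ^ 2 / (4 * (t * (1 - I * u)))) * cexp (-(I * m * ((t * √t * s : ℝ) : ℂ))) *
      cexp (-((π ^ 2 / (4 * t) : ℝ) : ℂ)) =
      cexp (-(((π ^ 2 / 4 * s ^ 2 : ℝ)) : ℂ) * (1 - I * u)⁻¹) *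
      cexp (I * (((π ^ 2 / (4 * t ^ 2) - m) * (t * √t) : ℝ) : ℂ) * s) := by
    rw [← Complex.exp_add, ← Complex.exp_add, ← Complex.exp_add]
    congr 1
    have ht2 : ((t : ℝ) : ℂ) = (√t : ℂ) ^ 2 := by
      rw [← Complex.ofReal_pow, Real.sq_sqrt h0.le]
    rw [hu] at hne ⊢
    push_cast at hne ⊢
    rw [ht2]
    generalize ((√t : ℝ) : ℂ) = σ at *
    have hW := mul_inv_cancel₀ hne
    rw [div_eq_mul_inv _ (4 * (σ ^ 2 * (1 - I * (σ * (s : ℂ))))), mul_inv, mul_inv]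
    generalize (1 - I * (σ * (s : ℂ)))⁻¹ = W at *
    field_simp
    linear_combination (1 + I * σ * s) * (π : ℂ) ^ 2 * hW + W * (π : ℂ) ^ 2 * σ ^ 2 * s ^ 2 * I_sq
  have e1 : ((rexp (-(π ^ 2 / (4 * t))) / √t : ℝ) : ℂ) = cexp (-((π ^ 2 / (4 * t) : ℝ) : ℂ)) / √t := by
    push_cast; rfl
  rw [e1, mul_assoc _ _ (cexp (I * _ * s)), ← hexp]
  generalize cexp (-((π ^ 2 / (4 * t) : ℝ) : ℂ)) = E1 at *
  generalize cexp (-(I * m * ((t * √t * s : ℝ) : ℂ))) = E2 at *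
  have : E1 / (√t : ℂ) * (PB (cexp (-(t * (1 - I * u)))) * E2) * GG (t * (1 - I * u)) =
      E1 / (√t : ℂ) * E2 * (PB (cexp (-(t * (1 - I * u)))) * GG (t * (1 - I * u))) := by ring
  rw [this, h1]
  field_simp

lemma GG_arg {t : ℝ} (ht : Good t) {s : ℝ} (hs : s ∈ Set.Ioc (-(1 / √t)) (1 / √t)) :
    π ^ 2 / (2 * t) ≤ (π ^ 2 / (t * (1 - I * ((√t * s : ℝ) : ℂ))) : ℂ).re ∧
      (√t * s) ^ 2 ≤ 1 := by
  have h0 := ht.1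
  have hσ : 0 < √t := Real.sqrt_pos.mpr h0
  have hu : (√t * s) ^ 2 ≤ 1 := by
    rw [sq_le_one_iff_abs_le_one, abs_mul, abs_of_pos hσ]
    have : |s| ≤ 1 / √t := abs_le.mpr ⟨hs.1.le, hs.2⟩
    calc √t * |s| ≤ √t * (1 / √t) := by gcongr
      _ = 1 := by field_simp
  refine ⟨?_, hu⟩
  have e : (π ^ 2 / (t * (1 - I * ((√t * s : ℝ) : ℂ))) : ℂ) =
      ((π ^ 2 / t : ℝ) : ℂ) * (1 - I * ((√t * s : ℝ) : ℂ))⁻¹ := by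
    push_cast; rw [div_mul_eq_div_div, div_eq_mul_inv]
  rw [e, Complex.re_ofReal_mul, inv_re, ← div_eq_mul_one_div, div_div]
  exact div_le_div_of_nonneg_left (by positivity) (by positivity) (by nlinarith)

lemma norm_KK_le {t : ℝ} (ht : Good t) (m : ℕ) (s : ℝ) :
    ‖KK t m s‖ ≤ rexp (-(π ^ 2 / 8) * s ^ 2) := by
  by_cases hs : s ∈ Set.Ioc (-(1 / √t)) (1 / √t)
  · obtain ⟨h1, h2⟩ := GG_arg ht hs
    have h3 := (ht.norm_GG h1).1
    have h4 := congrArg norm (KK_formula ht m hs)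
    rw [norm_mul, norm_mul, norm_mul] at h4
    set u : ℝ := √t * s with hu
    have a1 : ‖((1 - I * u : ℂ) / π) ^ (1 / 2 : ℂ)‖ ≤ 1 := by
      rw [show (1 / 2 : ℂ) = ((1 / 2 : ℝ) : ℂ) by push_cast; rfl, Complex.norm_cpow_real]
      apply Real.rpow_le_one (norm_nonneg _) _ (by norm_num)
      rw [norm_div, Complex.norm_real, Real.norm_of_nonneg Real.pi_pos.le,
        div_le_one Real.pi_pos]
      have : ‖(1 - I * u : ℂ)‖ ≤ 1 + |u| := by
        refine (norm_sub_le _ _).trans ?_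
        simp
      have hu1 : |u| ≤ 1 := (sq_le_one_iff_abs_le_one u).mp h2
      linarith [Real.pi_gt_three]
    have a2 : ‖cexp (-(((π ^ 2 / 4 * s ^ 2 : ℝ)) : ℂ) * (1 - I * u)⁻¹)‖ ≤
        rexp (-(π ^ 2 / 8) * s ^ 2) := by
      rw [Complex.norm_exp]
      apply Real.exp_le_exp.mpr
      rw [← Complex.ofReal_neg, Complex.re_ofReal_mul, inv_re]
      have : 1 / 2 ≤ 1 / (1 + u ^ 2) := by
        apply one_div_le_one_div_of_le <;> nlinarith
      have h5 : 0 ≤ π ^ 2 / 4 * s ^ 2 := by positivity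
      nlinarith
    have a3 : ‖cexp (I * (((π ^ 2 / (4 * t ^ 2) - m) * (t * √t) : ℝ) : ℂ) * s)‖ = 1 := by
      rw [show I * (((π ^ 2 / (4 * t ^ 2) - m) * (t * √t) : ℝ) : ℂ) * s =
        (((π ^ 2 / (4 * t ^ 2) - m) * (t * √t) * s : ℝ) : ℂ) * I by push_cast; ring]
      exact Complex.norm_exp_ofReal_mul_I _
    calc ‖KK t m s‖ = ‖KK t m s‖ * 1 := by ring
      _ ≤ _ := mul_le_mul_of_nonneg_left h3 (norm_nonneg _)
      _ = _ := h4
      _ ≤ 1 * rexp (-(π ^ 2 / 8) * s ^ 2) * 1 := by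
        rw [a3]; gcongr
      _ = _ := by ring
  · rw [KK, Set.indicator_of_notMem hs, norm_zero]
    exact (Real.exp_pos _).le

lemma integrable_gauss : Integrable (fun s : ℝ => rexp (-(π ^ 2 / 8) * s ^ 2)) :=
  integrable_exp_neg_mul_sq (by positivity)

lemma KK_meas {t : ℝ} (ht : 0 < t) (m : ℕ) : AEStronglyMeasurable (KK t m) := by
  apply AEStronglyMeasurable.indicator _ measurableSet_Ioc
  apply Continuous.aestronglyMeasurable
  exact continuous_const.mul ((continuous_Ph ht m).comp (by fun_prop))

lemma KK_integral {t : ℝ} (ht : 0 < t) (m : ℕ) :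
    ∫ s, KK t m s = ((rexp (-(π ^ 2 / (4 * t))) / t ^ 2 : ℝ) : ℂ) * ∫ θ in (-t)..t, Ph t m θ := by
  have hσ : 0 < √t := Real.sqrt_pos.mpr ht
  have hle : -(1 / √t) ≤ 1 / √t := by
    have : 0 < 1 / √t := by positivity
    linarith
  rw [KK, integral_indicator measurableSet_Ioc, ← intervalIntegral.integral_of_le hle,
    intervalIntegral.integral_const_mul,
    intervalIntegral.integral_comp_mul_left (fun x => Ph t m x) (by positivity)]
  have e1 : t * √t * -(1 / √t) = -t := by field_simp
  have e2 : t * √t * (1 / √t) = t := by field_simp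
  rw [e1, e2, Complex.real_smul, ← mul_assoc, ← Complex.ofReal_mul]
  congr 2
  have e3 : √t * √t = t := Real.mul_self_sqrt ht.le
  rw [div_mul_eq_mul_div, div_eq_div_iff (by positivity) (by positivity)]
  field_simp
  linear_combination (-1 : ℝ) * e3

/-- normalized coefficient -/
def Qn (t : ℝ) (m : ℕ) : ℝ := pb m * rexp (-t) ^ m * (rexp (-(π ^ 2 / (4 * t))) / t ^ 2)

lemma Qn_nonneg (t : ℝ) (m : ℕ) : 0 ≤ Qn t m := by
  have := pb_nonneg m
  unfold Qn
  positivity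

lemma main_split {t : ℝ} (ht : Good t) (m : ℕ) :
    ‖((2 * π * Qn t m : ℝ) : ℂ) - ∫ s, KK t m s‖ ≤ 2 * π * (√t / t ^ 2 * rexp (-(1 / 50 / t))) := by
  have h0 := ht.1
  have htpi : t ≤ π := by linarith [ht.2.1, Real.pi_gt_three]
  have hi : ∀ a b : ℝ, IntervalIntegrable (Ph t m) volume a b :=
    fun a b => (continuous_Ph h0 m).intervalIntegrable a b
  have h1 := pb_integral h0 m
  change ∫ θ in (-π)..π, Ph t m θ = _ at h1
  rw [← intervalIntegral.integral_add_adjacent_intervals (hi (-π) (-t)) (hi (-t) π),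
    ← intervalIntegral.integral_add_adjacent_intervals (hi (-t) t) (hi t π)] at h1
  set A : ℝ := rexp (-(π ^ 2 / (4 * t))) / t ^ 2 with hA
  have hA0 : 0 ≤ A := by positivity
  have e : ((2 * π * Qn t m : ℝ) : ℂ) - ∫ s, KK t m s =
      (A : ℂ) * ((∫ θ in (-π)..(-t), Ph t m θ) + ∫ θ in t..π, Ph t m θ) := by
    rw [KK_integral h0, Qn, ← hA]
    push_cast at h1 ⊢
    linear_combination (-(A : ℂ)) * h1
  set B : ℝ := √t * rexp (π ^ 2 / (4 * t)) * rexp (-(1 / 50 / t)) with hB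
  have hPh : ∀ θ : ℝ, t ≤ |θ| → |θ| ≤ π → ‖Ph t m θ‖ ≤ B := by
    intro θ a b
    rw [Ph, norm_mul]
    have : ‖cexp (-(I * m * θ))‖ = 1 := by
      rw [Complex.norm_exp]; simp
    rw [this, mul_one]
    exact minor_arc ht a b
  have b1 : ‖∫ θ in (-π)..(-t), Ph t m θ‖ ≤ B * |(-t) - (-π)| := by
    apply intervalIntegral.norm_integral_le_of_norm_le_const
    intro θ hθ
    rw [Set.uIoc_of_le (by linarith)] at hθ
    have : |θ| = -θ := abs_of_nonpos (by linarith [hθ.2])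
    exact hPh θ (by linarith [hθ.2]) (by linarith [hθ.1])
  have b2 : ‖∫ θ in t..π, Ph t m θ‖ ≤ B * |π - t| := by
    apply intervalIntegral.norm_integral_le_of_norm_le_const
    intro θ hθ
    rw [Set.uIoc_of_le (by linarith)] at hθ
    have : |θ| = θ := abs_of_nonneg (by linarith [hθ.1])
    exact hPh θ (by linarith [hθ.1]) (by linarith [hθ.2])
  have hB0 : 0 ≤ B := by positivity
  have hAB : A * B = √t / t ^ 2 * rexp (-(1 / 50 / t)) := by
    rw [hA, hB, Real.exp_neg (π ^ 2 / (4 * t))]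
    have := Real.exp_pos (π ^ 2 / (4 * t))
    field_simp
  rw [abs_of_nonneg (by linarith)] at b1 b2
  rw [e, norm_mul, Complex.norm_real, Real.norm_of_nonneg hA0, ← hAB]
  calc A * ‖(∫ θ in (-π)..(-t), Ph t m θ) + ∫ θ in t..π, Ph t m θ‖
      ≤ A * (B * (-t - -π) + B * (π - t)) := by
        gcongr
        exact (norm_add_le _ _).trans (add_le_add b1 b2)
    _ ≤ 2 * π * (A * B) := by
        have : 0 ≤ A * B := by positivity
        nlinarith

lemma minor_tendsto :
    Tendsto (fun t : ℝ => 2 * π * (√t / t ^ 2 * rexp (-(1 / 50 / t)))) (𝓝[>] 0) (𝓝 0) := by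
  suffices h : Tendsto (fun t : ℝ => (√t / t ^ 2 * rexp (-(1 / 50 / t)))) (𝓝[>] 0) (𝓝 0) by
    have h5 := h.const_mul (2 * π)
    rwa [mul_zero] at h5
  have h1 : Tendsto (fun x : ℝ => x ^ 2 * rexp (-(1 / 50 * x))) atTop (𝓝 0) := by
    have := Real.tendsto_pow_mul_exp_neg_atTop_nhds_zero 2
    have h2 := (this.comp (tendsto_id.const_mul_atTop (show (0 : ℝ) < 1 / 50 by norm_num))).const_mul
      (2500 : ℝ)
    rw [mul_zero] at h2
    refine h2.congr fun x => ?_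
    simp only [Function.comp, id]
    ring
  have h2 := h1.comp tendsto_inv_nhdsGT_zero
  have h3 : ∀ᶠ t : ℝ in 𝓝[>] 0, t ≤ 1 := nhdsWithin_le_nhds (Iic_mem_nhds (by norm_num))
  have h4 : ∀ᶠ t : ℝ in 𝓝[>] 0, 0 < t := self_mem_nhdsWithin
  refine tendsto_of_tendsto_of_tendsto_of_le_of_le' tendsto_const_nhds h2 ?_ ?_
  · filter_upwards [h4] with t ht
    positivity
  · filter_upwards [h3, h4] with t ht ht0
    simp only [Function.comp]
    rw [inv_pow, ← div_eq_mul_inv (1 / 50), div_eq_mul_inv (√t)]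
    gcongr
    have : √t ≤ 1 := Real.sqrt_le_one.mpr ht
    have h5 : 0 ≤ (t ^ 2)⁻¹ := by positivity
    nlinarith

/-- Theorem A -/
theorem thmA : ∃ C : ℝ, 0 < C ∧ ∀ᶠ t : ℝ in 𝓝[>] 0, ∀ m : ℕ, Qn t m ≤ C := by
  refine ⟨1 + ∫ s : ℝ, rexp (-(π ^ 2 / 8) * s ^ 2), ?_, ?_⟩
  · have : 0 ≤ ∫ s : ℝ, rexp (-(π ^ 2 / 8) * s ^ 2) := integral_nonneg fun s => (Real.exp_pos _).le
    linarith
  · filter_upwards [eventually_good, minor_tendsto.eventually (Iic_mem_nhds one_pos)] with t ht h1 m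
    have h2 := main_split ht m
    have h3 : ‖∫ s, KK t m s‖ ≤ ∫ s : ℝ, rexp (-(π ^ 2 / 8) * s ^ 2) :=
      norm_integral_le_of_norm_le integrable_gauss (Eventually.of_forall fun s => norm_KK_le ht m s)
    have h4 := norm_sub_norm_le ((2 * π * Qn t m : ℝ) : ℂ) (∫ s, KK t m s)
    rw [Complex.norm_real, Real.norm_of_nonneg (by have := Qn_nonneg t m; positivity)] at h4
    have h5 : Qn t m ≤ 2 * π * Qn t m := by
      have := Qn_nonneg t m
      nlinarith [Real.pi_gt_three]
    linarith

/-- Theorem B -/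
theorem thmB {t : ℕ → ℝ} {m : ℕ → ℕ} (ht : Tendsto t atTop (𝓝[>] 0))
    (hm : Tendsto (fun n => (π ^ 2 / (4 * t n ^ 2) - m n) * (t n * √(t n))) atTop (𝓝 0)) :
    Tendsto (fun n => Qn (t n) (m n)) atTop (𝓝 (1 / (2 * π ^ 2))) := by
  have hgood := ht.eventually eventually_good
  have ht0 : Tendsto t atTop (𝓝 0) := ht.mono_right nhdsWithin_le_nhds
  have hsq : Tendsto (fun n => √(t n)) atTop (𝓝 0) := by
    have h5 := (Real.continuous_sqrt.tendsto 0).comp ht0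
    rw [Real.sqrt_zero] at h5
    exact h5
  have hpoint : ∀ s : ℝ, Tendsto (fun n => KK (t n) (m n) s) atTop
      (𝓝 (((1 : ℂ) / π) ^ (1 / 2 : ℂ) * cexp (-(((π ^ 2 / 4 * s ^ 2 : ℝ)) : ℂ)) / 2)) := by
    intro s
    have hin : ∀ᶠ n in atTop, s ∈ Set.Ioc (-(1 / √(t n))) (1 / √(t n)) := by
      have h1 : Tendsto (fun n => √(t n) * |s|) atTop (𝓝 0) := by
        simpa using hsq.mul_const |s|
      filter_upwards [hgood, h1.eventually (Iio_mem_nhds one_pos)] with n hn h2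
      have hσ : 0 < √(t n) := Real.sqrt_pos.mpr hn.1
      have h3 : |s| < 1 / √(t n) := by
        rw [lt_div_iff₀ hσ]; linarith
      exact ⟨(abs_lt.mp h3).1, (abs_lt.mp h3).2.le⟩
    have hu : Tendsto (fun n => (1 - I * ((√(t n) * s : ℝ) : ℂ))) atTop (𝓝 1) := by
      have : Tendsto (fun n => √(t n) * s) atTop (𝓝 0) := by simpa using hsq.mul_const s
      have h2 := ((Complex.continuous_ofReal.tendsto _).comp this).const_mul I
      simpa [Function.comp] using h2.const_sub 1
    have hG : Tendsto (fun n => GG (t n * (1 - I * ((√(t n) * s : ℝ) : ℂ)))) atTop (𝓝 2) := by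
      rw [tendsto_iff_norm_sub_tendsto_zero]
      have hb := ((tendsto_exp_neg_div (c := π ^ 2 / 2) (by positivity)).const_mul C0).comp ht
      rw [mul_zero] at hb
      refine tendsto_of_tendsto_of_tendsto_of_le_of_le' tendsto_const_nhds hb
        (Eventually.of_forall fun _ => norm_nonneg _) ?_
      filter_upwards [hgood, hin] with n hn hs
      have := (hn.norm_GG (GG_arg hn hs).1).2
      simp only [Function.comp]
      rwa [div_div]
    have hR : Tendsto (fun n => ((1 - I * ((√(t n) * s : ℝ) : ℂ)) / π) ^ (1 / 2 : ℂ) *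
      cexp (-(((π ^ 2 / 4 * s ^ 2 : ℝ)) : ℂ) * (1 - I * ((√(t n) * s : ℝ) : ℂ))⁻¹) *
      cexp (I * (((π ^ 2 / (4 * t n ^ 2) - m n) * (t n * √(t n)) : ℝ) : ℂ) * s)) atTop
      (𝓝 (((1 : ℂ) / π) ^ (1 / 2 : ℂ) * cexp (-(((π ^ 2 / 4 * s ^ 2 : ℝ)) : ℂ) * 1⁻¹) *
        cexp (I * ((0 : ℝ) : ℂ) * s))) := by
      refine Tendsto.mul (Tendsto.mul ?_ ?_) ?_
      · have hc : ContinuousAt (fun x : ℂ => x ^ (1 / 2 : ℂ)) (1 / π) := by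
          apply continuousAt_cpow_const
          rw [show (1 / π : ℂ) = ((1 / π : ℝ) : ℂ) by push_cast; rfl]
          exact Complex.ofReal_mem_slitPlane.mpr (by positivity)
        exact hc.tendsto.comp (hu.div_const _)
      · exact (Complex.continuous_exp.tendsto _).comp ((hu.inv₀ one_ne_zero).const_mul _)
      · exact (Complex.continuous_exp.tendsto _).comp
          ((((Complex.continuous_ofReal.tendsto _).comp hm).const_mul I).mul_const _)
    have hq := hR.div hG two_ne_zero
    simp only [inv_one, mul_one, Complex.ofReal_zero, mul_zero, zero_mul, Complex.exp_zero] at hq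
    refine hq.congr' ?_
    filter_upwards [hgood, hin] with n hn hs
    have h1 := (hn.norm_GG (GG_arg hn hs).1).1
    simp only [Pi.div_apply]
    rw [← KK_formula hn (m n) hs]
    apply mul_div_cancel_right₀
    rw [← norm_pos_iff]
    linarith
  have hIntg : Tendsto (fun n => ∫ s, KK (t n) (m n) s) atTop
      (𝓝 (∫ s : ℝ, ((1 : ℂ) / π) ^ (1 / 2 : ℂ) * cexp (-(((π ^ 2 / 4 * s ^ 2 : ℝ)) : ℂ)) / 2)) := by
    refine tendsto_integral_filter_of_dominated_convergence
      (fun s : ℝ => rexp (-(π ^ 2 / 8) * s ^ 2)) ?_ ?_ integrable_gauss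
      (Eventually.of_forall hpoint)
    · filter_upwards [hgood] with n hn
      exact KK_meas hn.1 _
    · filter_upwards [hgood] with n hn
      exact Eventually.of_forall fun s => norm_KK_le hn _ s
  have hval : ∫ s : ℝ, ((1 : ℂ) / π) ^ (1 / 2 : ℂ) * cexp (-(((π ^ 2 / 4 * s ^ 2 : ℝ)) : ℂ)) / 2 =
      ((1 / π : ℝ) : ℂ) := by
    have e : ∀ s : ℝ, ((1 : ℂ) / π) ^ (1 / 2 : ℂ) * cexp (-(((π ^ 2 / 4 * s ^ 2 : ℝ)) : ℂ)) / 2 =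
        ((√(1 / π) / 2 * rexp (-(π ^ 2 / 4) * s ^ 2) : ℝ) : ℂ) := by
      intro s
      rw [show ((1 : ℂ) / π) = ((1 / π : ℝ) : ℂ) by push_cast; rfl,
        show (1 / 2 : ℂ) = ((1 / 2 : ℝ) : ℂ) by push_cast; rfl,
        ← Complex.ofReal_cpow (by positivity), ← Real.sqrt_eq_rpow]
      push_cast
      ring_nf
    simp_rw [e]
    rw [integral_complex_ofReal, integral_const_mul, integral_gaussian]
    congr 1
    rw [show π / (π ^ 2 / 4) = 4 * (1 / π) by field_simp, Real.sqrt_mul (by norm_num),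
      show (4 : ℝ) = 2 ^ 2 by norm_num, Real.sqrt_sq (by norm_num)]
    have := Real.mul_self_sqrt (show 0 ≤ 1 / π by positivity)
    linear_combination this
  rw [hval] at hIntg
  have hdiff : Tendsto (fun n => ((2 * π * Qn (t n) (m n) : ℝ) : ℂ) - ∫ s, KK (t n) (m n) s) atTop
      (𝓝 0) := by
    refine squeeze_zero_norm' ?_ (minor_tendsto.comp ht)
    filter_upwards [hgood] with n hn
    exact main_split hn _
  have hfin := hdiff.add hIntg
  simp only [sub_add_cancel, zero_add] at hfin
  have hre := ((Complex.continuous_re.tendsto _).comp hfin).const_mul (1 / (2 * π))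
  simp only [Complex.ofReal_re, Function.comp] at hre
  rw [show 1 / (2 * π ^ 2) = 1 / (2 * π) * (1 / π) by field_simp]
  refine hre.congr fun n => ?_
  field_simp

end OB

namespace OB
open PowerSeries MeasureTheory

def aa (n : ℕ) : ℝ := √(√(n : ℝ))
def tt (n : ℕ) : ℝ := π / (2 * aa n ^ 2)

lemma aa_sq (n : ℕ) : aa n ^ 2 = √(n : ℝ) := Real.sq_sqrt (Real.sqrt_nonneg _)

lemma aa_four (n : ℕ) : aa n ^ 4 = n := by
  rw [show aa n ^ 4 = (aa n ^ 2) ^ 2 by ring, aa_sq, Real.sq_sqrt (Nat.cast_nonneg n)]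

lemma aa_nonneg (n : ℕ) : 0 ≤ aa n := Real.sqrt_nonneg _

lemma tendsto_aa : Tendsto aa atTop atTop :=
  Real.tendsto_sqrt_atTop.comp (Real.tendsto_sqrt_atTop.comp tendsto_natCast_atTop_atTop)

lemma aa_ge_one {n : ℕ} (hn : 1 ≤ n) : 1 ≤ aa n := by
  unfold aa
  rw [Real.one_le_sqrt, Real.one_le_sqrt]
  exact_mod_cast hn

lemma tt_pos {n : ℕ} (hn : 1 ≤ n) : 0 < tt n := by
  have := aa_ge_one hn
  unfold tt
  positivity

lemma tendsto_tt0 : Tendsto tt atTop (𝓝 0) := by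
  have h1 : Tendsto (fun n => 2 * aa n ^ 2) atTop atTop :=
    ((tendsto_pow_atTop two_ne_zero).comp tendsto_aa).const_mul_atTop two_pos
  exact h1.const_div_atTop π

lemma tendsto_tt : Tendsto tt atTop (𝓝[>] 0) := by
  rw [tendsto_nhdsWithin_iff]
  refine ⟨tendsto_tt0, ?_⟩
  filter_upwards [eventually_ge_atTop 1] with n hn
  exact tt_pos hn

lemma tt_n {n : ℕ} (hn : 1 ≤ n) : π ^ 2 / (4 * tt n ^ 2) = n := by
  have h := aa_ge_one hn
  rw [← aa_four n]
  unfold tt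
  field_simp
  norm_num

lemma tt_sqrt_lim : Tendsto (fun n => √(tt n)) atTop (𝓝 0) := by
  have h5 := (Real.continuous_sqrt.tendsto 0).comp tendsto_tt0
  rw [Real.sqrt_zero] at h5
  exact h5

lemma pb_ratio (t : ℝ) (ht : t ≠ 0) {n j : ℕ} (hj : j ≤ n) :
    pb (n - j) / pb n = Qn t (n - j) / Qn t n * rexp (-(t * j)) := by
  unfold Qn
  have e : rexp (-t) ^ n = rexp (-t) ^ (n - j) * rexp (-(t * j)) := by
    rw [show -(t * j) = (j : ℝ) * (-t) by ring, Real.exp_nat_mul, ← pow_add, Nat.sub_add_cancel hj]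
  rw [e]
  have h1 := Real.exp_pos (-t)
  have h2 := Real.exp_pos (-(t * j))
  have h3 := Real.exp_pos (-(π ^ 2 / (4 * t)))
  by_cases h : pb n = 0
  · simp [h]
  · field_simp

lemma Qn_lim {j : ℕ → ℕ} (hj : ∀ᶠ n in atTop, j n ≤ n)
    (h : Tendsto (fun n => tt n * j n * √(tt n)) atTop (𝓝 0)) :
    Tendsto (fun n => Qn (tt n) (n - j n)) atTop (𝓝 (1 / (2 * π ^ 2))) := by
  refine thmB (m := fun n => n - j n) tendsto_tt (h.congr' ?_)
  filter_upwards [hj, eventually_ge_atTop 1] with n h1 h2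
  rw [tt_n h2, Nat.cast_sub h1]
  ring

lemma Qn_lim0 : Tendsto (fun n => Qn (tt n) n) atTop (𝓝 (1 / (2 * π ^ 2))) :=
  Qn_lim (j := fun _ => 0) (Eventually.of_forall fun n => Nat.zero_le n) (by simp)

lemma ratio_tendsto {j : ℕ → ℕ} {L : ℝ} (hj : ∀ᶠ n in atTop, j n ≤ n)
    (h : Tendsto (fun n => tt n * j n) atTop (𝓝 L)) :
    Tendsto (fun n => pb (n - j n) / pb n) atTop (𝓝 (rexp (-L))) := by
  have h1 := Qn_lim hj (by simpa using h.mul tt_sqrt_lim)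
  have h2 := (h1.div Qn_lim0 (by positivity)).mul ((Real.continuous_exp.tendsto _).comp h.neg)
  rw [div_self (by positivity), one_mul] at h2
  refine h2.congr' ?_
  filter_upwards [hj, eventually_ge_atTop 1] with n h3 h4
  exact (pb_ratio _ (tt_pos h4).ne' h3).symm

lemma Qn_low : ∀ᶠ n in atTop, 1 / (4 * π ^ 2) ≤ Qn (tt n) n := by
  have : 1 / (4 * π ^ 2) < 1 / (2 * π ^ 2) := by
    apply one_div_lt_one_div_of_lt (by positivity)
    nlinarith [sq_pos_of_pos Real.pi_pos]
  exact (Qn_lim0.eventually (Ioi_mem_nhds this)).mono fun n hn => le_of_lt hn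

lemma pb_pos_ev : ∀ᶠ n in atTop, 0 < pb n := by
  filter_upwards [Qn_low] with n hn
  have h1 : 0 < Qn (tt n) n := lt_of_lt_of_le (by positivity) hn
  rcases (pb_nonneg n).lt_or_eq with h | h
  · exact h
  · rw [Qn, ← h] at h1
    simp at h1

lemma ratio_bound : ∃ C : ℝ, 0 < C ∧ ∀ᶠ n in atTop, ∀ j ≤ n,
    pb (n - j) / pb n ≤ C * rexp (-(tt n * j)) := by
  obtain ⟨C, hC, h⟩ := thmA
  refine ⟨C / (1 / (4 * π ^ 2)), by positivity, ?_⟩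
  filter_upwards [Qn_low, tendsto_tt.eventually h, eventually_ge_atTop 1] with n h1 h2 h3 j hj
  rw [pb_ratio _ (tt_pos h3).ne' hj]
  gcongr
  exact h2 _

/-- step function summands -/
def FF (n k : ℕ) : ℝ := if k * (k + 1) / 2 ≤ n then pb (n - k * (k + 1) / 2) / pb n else 0

lemma sC_FF (n : ℕ) : sC n / pb n = ∑ k ∈ Finset.range (n + 1), FF n k := by
  unfold sC FF
  rw [Finset.sum_div]
  refine Finset.sum_congr rfl fun k _ => ?_
  split_ifs <;> simp

lemma FF_nonneg (n k : ℕ) : 0 ≤ FF n k := by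
  unfold FF
  have := pb_nonneg
  split_ifs
  · exact div_nonneg (this _) (this _)
  · exact le_rfl

def HH (n : ℕ) : ℝ → ℝ := Set.indicator (Set.Ioc 0 ((n + 1) / aa n)) (fun x => FF n ⌊aa n * x⌋₊)

lemma step_int (g : ℕ → ℝ) (N : ℕ) : ∫ y in (0 : ℝ)..N, g ⌊y⌋₊ = ∑ k ∈ Finset.range N, g k := by
  have key : ∀ k : ℕ, Set.EqOn (fun y : ℝ => g k) (fun y : ℝ => g ⌊y⌋₊) (Set.Ioo (k : ℝ) (k + 1)) := by
    intro k y hy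
    have : ⌊y⌋₊ = k := by
      rw [Nat.floor_eq_iff (by linarith [hy.1, Nat.cast_nonneg (α := ℝ) k])]
      exact ⟨hy.1.le, hy.2⟩
    simp only [this]
  have hIntg : ∀ k : ℕ, IntervalIntegrable (fun y : ℝ => g ⌊y⌋₊) volume (k : ℝ) ((k + 1 : ℕ) : ℝ) := by
    intro k
    push_cast
    refine IntervalIntegrable.congr_uIoo (f := fun _ => g k) intervalIntegrable_const ?_
    rw [Set.uIoo_of_le (by linarith)]
    exact key k
  have h1 := intervalIntegral.sum_integral_adjacent_intervals (f := fun y : ℝ => g ⌊y⌋₊) (μ := volume)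
    (a := fun k : ℕ => (k : ℝ)) (n := N) (fun k _ => hIntg k)
  simp only [Nat.cast_zero] at h1
  rw [← h1]
  refine Finset.sum_congr rfl fun k _ => ?_
  push_cast
  rw [← intervalIntegral.integral_congr_uIoo (f := fun _ => g k)]
  · simp
  · rw [Set.uIoo_of_le (by linarith)]
    exact key k

lemma HH_int {n : ℕ} (hn : 1 ≤ n) : ∫ x, HH n x = sC n / (aa n * pb n) := by
  have ha := aa_ge_one hn
  have ha0 : 0 < aa n := by linarith
  rw [HH, integral_indicator measurableSet_Ioc,
    ← intervalIntegral.integral_of_le (by positivity),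
    intervalIntegral.integral_comp_mul_left (fun y => FF n ⌊y⌋₊) ha0.ne', mul_zero,
    mul_div_cancel₀ _ ha0.ne', ← Nat.cast_one, ← Nat.cast_add, step_int, ← sC_FF, smul_eq_mul]
  field_simp

lemma HH_meas (n : ℕ) : AEStronglyMeasurable (HH n) := by
  apply AEStronglyMeasurable.indicator _ measurableSet_Ioc
  apply Measurable.aestronglyMeasurable
  exact (measurable_from_nat (f := FF n)).comp (Nat.measurable_floor.comp (measurable_const_mul _))

lemma tri_cast (k : ℕ) : ((k * (k + 1) / 2 : ℕ) : ℝ) = k * (k + 1) / 2 := by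
  rw [Nat.cast_div (Nat.even_mul_succ_self k).two_dvd (by norm_num)]
  push_cast
  rfl

lemma tt_tri {n : ℕ} (hn : 1 ≤ n) (k : ℕ) :
    tt n * ((k * (k + 1) / 2 : ℕ) : ℝ) = π / 4 * (k / aa n * (k / aa n + 1 / aa n)) := by
  have := aa_ge_one hn
  rw [tri_cast, tt]
  field_simp
  ring

lemma HH_bound : ∃ C : ℝ, ∀ᶠ n in atTop, ∀ x, ‖HH n x‖ ≤ C * rexp (-(π / 8) * x ^ 2) := by
  obtain ⟨C, hC, h⟩ := ratio_bound
  refine ⟨C * rexp (π / 8), ?_⟩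
  filter_upwards [h, eventually_ge_atTop 1] with n h1 hn x
  have ha := aa_ge_one hn
  have ha0 : 0 < aa n := by linarith
  by_cases hx : x ∈ Set.Ioc 0 ((n + 1) / aa n)
  · rw [HH, Set.indicator_of_mem hx, Real.norm_of_nonneg (FF_nonneg _ _), FF]
    split_ifs with h2
    · refine (h1 _ h2).trans ?_
      rw [mul_assoc, ← Real.exp_add]
      gcongr
      rw [tt_tri hn]
      set k := ⌊aa n * x⌋₊
      have hk : aa n * x < k + 1 := Nat.lt_floor_add_one _
      have hk1 : x < k / aa n + 1 / aa n := by
        rw [← add_div, lt_div_iff₀ ha0]; linarith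
      have h3 : 1 / aa n ≤ 1 := by rw [div_le_one ha0]; exact ha
      have h4 : 0 ≤ (k : ℝ) / aa n := by positivity
      have h5 : x * (x - 1) ≤ k / aa n * (k / aa n + 1 / aa n) := by
        by_cases h6 : x ≤ 1
        · have : 0 ≤ k / aa n * (k / aa n + 1 / aa n) := by positivity
          nlinarith [hx.1]
        · nlinarith [hx.1]
      nlinarith [Real.pi_pos, sq_nonneg (x - 1)]
    · positivity
  · rw [HH, Set.indicator_of_notMem hx, norm_zero]
    positivity

lemma HH_point (x : ℝ) : Tendsto (fun n => HH n x) atTop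
    (𝓝 (Set.indicator (Set.Ioi 0) (fun x => rexp (-(π / 4) * x ^ 2)) x)) := by
  by_cases hx : 0 < x
  · rw [Set.indicator_of_mem (Set.mem_Ioi.mpr hx)]
    set k : ℕ → ℕ := fun n => ⌊aa n * x⌋₊ with hk
    have h1 : Tendsto (fun n => (k n : ℝ) / aa n) atTop (𝓝 x) := by
      have := (tendsto_nat_floor_mul_div_atTop hx.le).comp tendsto_aa
      refine this.congr fun n => ?_
      simp only [Function.comp, hk, mul_comm]
    have h2 : Tendsto (fun n => 1 / aa n) atTop (𝓝 0) := tendsto_aa.const_div_atTop 1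
    have h3 : Tendsto (fun n => tt n * ((k n * (k n + 1) / 2 : ℕ) : ℝ)) atTop (𝓝 (π / 4 * x ^ 2)) := by
      have h4 := (h1.mul (h1.add h2)).const_mul (π / 4)
      rw [add_zero, ← sq] at h4
      refine h4.congr' ?_
      filter_upwards [eventually_ge_atTop 1] with n hn
      rw [tt_tri hn]
    have hle : ∀ᶠ n in atTop, k n * (k n + 1) / 2 ≤ n := by
      have h5 : Tendsto (fun n => π / 2 * aa n ^ 2) atTop atTop :=
        ((tendsto_pow_atTop two_ne_zero).comp tendsto_aa).const_mul_atTop (by positivity)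
      filter_upwards [h3.eventually (Iio_mem_nhds (show π / 4 * x ^ 2 < π / 4 * x ^ 2 + 1 by linarith)),
        h5.eventually_ge_atTop (π / 4 * x ^ 2 + 1), eventually_ge_atTop 1] with n a b hn
      have ha := aa_ge_one hn
      have e : π / 2 * aa n ^ 2 = tt n * n := by
        rw [← aa_four n, tt]
        field_simp
      rw [e] at b
      have h6 : tt n * ((k n * (k n + 1) / 2 : ℕ) : ℝ) < tt n * n := lt_of_lt_of_le a b
      have h7 := lt_of_mul_lt_mul_left h6 (tt_pos hn).le
      exact_mod_cast h7.le
    have hr := ratio_tendsto hle h3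
    rw [← neg_mul] at hr
    have hin : ∀ᶠ n : ℕ in atTop, x ≤ (n + 1) / aa n := by
      filter_upwards [tendsto_aa.eventually_ge_atTop x, eventually_ge_atTop 1] with n a hn
      have ha := aa_ge_one hn
      refine a.trans ?_
      rw [le_div_iff₀ (by linarith), ← aa_four n]
      nlinarith [mul_self_nonneg (aa n), mul_self_nonneg (aa n ^ 2 - 1)]
    refine hr.congr' ?_
    filter_upwards [hle, hin] with n a b
    rw [HH, Set.indicator_of_mem (Set.mem_Ioc.mpr ⟨hx, b⟩), FF, if_pos a]
  · rw [Set.indicator_of_notMem (by simpa using hx)]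
    refine tendsto_const_nhds.congr fun n => ?_
    rw [HH, Set.indicator_of_notMem]
    exact fun h => hx h.1

theorem sC_lim : Tendsto (fun n => sC n / (aa n * pb n)) atTop (𝓝 1) := by
  obtain ⟨C, hC⟩ := HH_bound
  have h := tendsto_integral_filter_of_dominated_convergence
    (fun x : ℝ => C * rexp (-(π / 8) * x ^ 2)) (Eventually.of_forall HH_meas)
    (hC.mono fun n hn => Eventually.of_forall hn)
    ((integrable_exp_neg_mul_sq (by positivity)).const_mul C)
    (Eventually.of_forall HH_point)
  rw [integral_indicator measurableSet_Ioi, integral_gaussian_Ioi] at h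
  have e : √(π / (π / 4)) / 2 = 1 := by
    rw [show π / (π / 4) = 2 ^ 2 by field_simp; norm_num, Real.sqrt_sq (by norm_num)]
    norm_num
  rw [e] at h
  refine h.congr' ?_
  filter_upwards [eventually_ge_atTop 1] with n hn
  exact HH_int hn

lemma pb_succ_lim : Tendsto (fun n => pb (n + 1) / pb n) atTop (𝓝 1) := by
  have h := ratio_tendsto (j := fun _ => 1) (L := 0) (eventually_ge_atTop 1)
    (by simpa using tendsto_tt0)
  rw [neg_zero, Real.exp_zero] at h
  have h2 := (h.inv₀ one_ne_zero).comp (tendsto_add_atTop_nat 1)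
  rw [inv_one] at h2
  refine h2.congr fun n => ?_
  simp

lemma aa_succ_lim : Tendsto (fun n => aa (n + 1) / aa n) atTop (𝓝 1) := by
  have h1 : Tendsto (fun n : ℕ => ((n : ℝ) + 1) / n) atTop (𝓝 1) := by
    have := (tendsto_one_div_atTop_nhds_zero_nat (𝕜 := ℝ)).const_add 1
    rw [add_zero] at this
    refine this.congr' ?_
    filter_upwards [eventually_ge_atTop 1] with n hn
    have : (n : ℝ) ≠ 0 := by positivity
    field_simp
  have h2 := (Real.continuous_sqrt.tendsto _).comp ((Real.continuous_sqrt.tendsto _).comp h1)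
  rw [Real.sqrt_one, Real.sqrt_one] at h2
  refine h2.congr fun n => ?_
  simp only [Function.comp, aa]
  rw [Real.sqrt_div (by positivity), Real.sqrt_div (by positivity)]
  push_cast
  rfl

def ff (n : ℕ) : ℝ := aa n * pb n

lemma ff_pos_ev : ∀ᶠ n in atTop, 0 < ff n := by
  filter_upwards [pb_pos_ev, eventually_ge_atTop 1] with n h1 h2
  have := aa_ge_one h2
  unfold ff
  positivity

lemma ff_succ_lim : Tendsto (fun n => ff (n + 1) / ff n) atTop (𝓝 1) := by
  have := aa_succ_lim.mul pb_succ_lim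
  rw [one_mul] at this
  refine this.congr fun n => ?_
  unfold ff
  rw [div_mul_div_comm]

lemma sC_shift (k : ℕ) : Tendsto (fun n => sC (n + k) / ff n) atTop (𝓝 1) := by
  have hk : ∀ k : ℕ, Tendsto (fun n => ff (n + k) / ff n) atTop (𝓝 1) := by
    intro k
    induction k with
    | zero =>
      refine (tendsto_const_nhds (x := (1 : ℝ))).congr' ?_
      filter_upwards [ff_pos_ev] with n hn
      rw [add_zero, div_self hn.ne']
    | succ k ih =>
      have h2 := (ff_succ_lim.comp (tendsto_add_atTop_nat k)).mul ih
      rw [one_mul] at h2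
      refine h2.congr' ?_
      filter_upwards [(tendsto_add_atTop_nat k).eventually ff_pos_ev] with n hn
      simp only [Function.comp]
      rw [div_mul_div_cancel₀ hn.ne', add_assoc]
  have h2 := (sC_lim.comp (tendsto_add_atTop_nat k)).mul (hk k)
  rw [one_mul] at h2
  refine h2.congr' ?_
  filter_upwards [(tendsto_add_atTop_nat k).eventually ff_pos_ev] with n hn
  simp only [Function.comp]
  exact div_mul_div_cancel₀ hn.ne'

theorem vt_lim : Tendsto (fun n => vt n / ff n) atTop (𝓝 (1 / 2)) := by
  have u : Tendsto (fun n => 1 / 2 * (sC (n + 1) / ff n)) atTop (𝓝 (1 / 2)) := by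
    have := (sC_shift 1).const_mul (1 / 2)
    rwa [mul_one] at this
  have l : Tendsto (fun n => 2 / 3 * (sC (n + 1) / ff n) - 1 / 6 * (sC (n + 3) / ff n)) atTop
      (𝓝 (1 / 2)) := by
    have := ((sC_shift 1).const_mul (2 / 3)).sub ((sC_shift 3).const_mul (1 / 6))
    rwa [show (2 / 3 * 1 - 1 / 6 * 1 : ℝ) = 1 / 2 by norm_num] at this
  refine tendsto_of_tendsto_of_tendsto_of_le_of_le' l u ?_ ?_
  · filter_upwards [ff_pos_ev, eventually_ge_atTop 1] with n h hn
    obtain ⟨m, rfl⟩ := Nat.exists_eq_add_of_le' hn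
    have := sC_le m
    rw [← mul_div_assoc, ← mul_div_assoc, ← sub_div]
    gcongr
    rw [show m + 1 + 1 = m + 2 by ring, show m + 1 + 3 = m + 4 by ring]
    linarith
  · filter_upwards [ff_pos_ev, eventually_ge_atTop 1] with n h hn
    obtain ⟨m, rfl⟩ := Nat.exists_eq_add_of_le' hn
    have := two_vt_le m
    rw [← mul_div_assoc]
    gcongr
    rw [show m + 1 + 1 = m + 2 by ring]
    linarith

end OB

namespace OB
open PowerSeries

/-- multisets of odd parts `< 2K` with sum `m` -/
def RR (m K : ℕ) : Finset (Multiset ℕ) :=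
  (Nat.Partition.restricted m (fun x => Odd x ∧ x < 2 * K)).image (fun p => p.parts)

lemma mem_RR {m K : ℕ} {M : Multiset ℕ} :
    M ∈ RR m K ↔ M.sum = m ∧ ∀ x ∈ M, Odd x ∧ x < 2 * K := by
  unfold RR Nat.Partition.restricted
  simp only [Finset.mem_image, Finset.mem_filter, Finset.mem_univ, true_and]
  constructor
  · rintro ⟨p, hp, rfl⟩
    exact ⟨p.parts_sum, hp⟩
  · rintro ⟨h1, h2⟩
    exact ⟨⟨M, fun {i} hi => (h2 i hi).1.pos, h1⟩, h2, rfl⟩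

lemma RR_zero_left_card (m : ℕ) : (RR m 0).card = if m = 0 then 1 else 0 := by
  split_ifs with h
  · rw [Finset.card_eq_one]
    refine ⟨0, ?_⟩
    ext M
    rw [mem_RR, Finset.mem_singleton]
    constructor
    · rintro ⟨_, h2⟩
      apply Multiset.eq_zero_of_forall_notMem
      intro x hx
      have := (h2 x hx).2
      omega
    · rintro rfl
      simp [h]
  · rw [Finset.card_eq_zero]
    apply Finset.eq_empty_of_forall_notMem
    intro M hM
    rw [mem_RR] at hM
    have : M = 0 := by
      apply Multiset.eq_zero_of_forall_notMem
      intro x hx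
      have := (hM.2 x hx).2
      omega
    rw [this] at hM
    exact h hM.1.symm

lemma RR_succ_card (m K : ℕ) : (RR m (K + 1)).card =
    (RR m K).card + if 2 * K + 1 ≤ m then (RR (m - (2 * K + 1)) (K + 1)).card else 0 := by
  have hinj : Function.Injective (fun M : Multiset ℕ => (2 * K + 1) ::ₘ M) :=
    fun _ _ h => (Multiset.cons_inj_right _).mp h
  split_ifs with hle
  · rw [← Finset.card_image_of_injective (RR (m - (2 * K + 1)) (K + 1)) hinj,
      ← Finset.card_union_of_disjoint]
    · congr 1
      ext M
      simp only [Finset.mem_union, Finset.mem_image, mem_RR]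
      constructor
      · rintro ⟨h1, h2⟩
        by_cases h : 2 * K + 1 ∈ M
        · right
          refine ⟨M.erase (2 * K + 1), ⟨?_, ?_⟩, Multiset.cons_erase h⟩
          · have := Multiset.sum_erase h
            omega
          · intro x hx
            exact h2 x (Multiset.mem_of_mem_erase hx)
        · left
          refine ⟨h1, fun x hx => ⟨(h2 x hx).1, ?_⟩⟩
          have h3 := (h2 x hx).2
          obtain ⟨y, hy⟩ := (h2 x hx).1
          have : x ≠ 2 * K + 1 := fun h4 => h (h4 ▸ hx)
          omega
      · rintro (⟨h1, h2⟩ | ⟨N, ⟨h1, h2⟩, rfl⟩)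
        · refine ⟨h1, fun x hx => ⟨(h2 x hx).1, ?_⟩⟩
          have := (h2 x hx).2
          omega
        · refine ⟨?_, ?_⟩
          · rw [Multiset.sum_cons]; omega
          · intro x hx
            rcases Multiset.mem_cons.mp hx with rfl | hx
            · exact ⟨⟨K, rfl⟩, by omega⟩
            · exact h2 x hx
    · rw [Finset.disjoint_left]
      intro M h1 h2
      rw [Finset.mem_image] at h2
      obtain ⟨N, _, rfl⟩ := h2
      have := ((mem_RR.mp h1).2 (2 * K + 1) (Multiset.mem_cons_self _ _)).2
      omega
  · rw [add_zero]
    congr 1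
    ext M
    simp only [mem_RR]
    refine and_congr_right fun h1 => forall₂_congr fun x hx => and_congr_right fun h2 => ?_
    have := Multiset.le_sum_of_mem hx
    obtain ⟨y, hy⟩ := h2
    omega

/-- odd product -/
def OK (K : Type*) [CommRing K] (n : ℕ) : PowerSeries K := ∏ k ∈ Finset.range n, gInv K (2 * k + 1)

lemma coeff_OK (K : Type*) [CommRing K] (k m : ℕ) : coeff m (OK K k) = ((RR m k).card : K) := by
  induction k generalizing m with
  | zero =>
    rw [OK, Finset.prod_range_zero, coeff_one, RR_zero_left_card]
    split_ifs <;> simp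
  | succ k ih =>
    induction m using Nat.strong_induction_on with
    | _ m ihm =>
      have h1 : (1 - (X : PowerSeries K) ^ (2 * k + 1)) * OK K (k + 1) = OK K k := by
        have h := gInv_mul K (k := 2 * k + 1) (Nat.succ_pos (2 * k))
        rw [OK, OK, Finset.prod_range_succ]
        linear_combination (∏ k ∈ Finset.range k, gInv K (2 * k + 1)) * h
      have h2 := congrArg (coeff m) h1
      rw [sub_mul, one_mul, map_sub, coeff_X_pow_mul', ih m] at h2
      rw [RR_succ_card]
      split_ifs at h2 ⊢ with hle
      · rw [ihm (m - (2 * k + 1)) (by omega)] at h2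
        push_cast
        linear_combination h2
      · push_cast
        linear_combination h2

/-- with offset -/
def RS (s n K : ℕ) : Finset (Multiset ℕ) := if s ≤ n then RR (n - s) K else ∅

lemma mem_RS {s n K : ℕ} {M : Multiset ℕ} :
    M ∈ RS s n K ↔ M.sum + s = n ∧ ∀ x ∈ M, Odd x ∧ x < 2 * K := by
  unfold RS
  split_ifs with h
  · rw [mem_RR]
    refine and_congr_left fun _ => ?_
    omega
  · simp only [Finset.notMem_empty, false_iff, not_and]
    intro h1
    omega

lemma coeff_XOK (K : Type*) [CommRing K] (s n k : ℕ) :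
    coeff n (X ^ s * OK K k) = ((RS s n k).card : K) := by
  rw [coeff_X_pow_mul', RS]
  split_ifs
  · rw [coeff_OK]
  · simp

def sm (A : Finset ℕ) : ℕ := ∑ a ∈ A, (a + 1)

/-- data -/
def Om (n : ℕ) : Finset (Σ _ : ℕ, Σ _ : Finset ℕ × Finset ℕ, Multiset ℕ) :=
  (Finset.range (n + 1)).sigma fun k =>
    ((Finset.range k).powerset ×ˢ (Finset.range k).powerset).sigma fun AB =>
      RS (k + sm AB.1 + sm AB.2) n (k + 1)

/-- `V_w` truncated -/
def VW {K : Type*} [Field K] (w : K) (N : ℕ) : PowerSeries K :=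
  ∑ k ∈ Finset.range N, X ^ k * ((∏ j ∈ Finset.range k, (1 + C w⁻¹ * X ^ (j + 1))) *
    (∏ j ∈ Finset.range k, (1 + C w * X ^ (j + 1)))) * OK K (k + 1)

lemma prod_exp {K : Type*} [Field K] (w : K) (k : ℕ) :
    ∏ j ∈ Finset.range k, (1 + C w * (X : PowerSeries K) ^ (j + 1)) =
      ∑ A ∈ (Finset.range k).powerset, C (w ^ A.card) * X ^ (sm A) := by
  rw [Finset.prod_one_add]
  refine Finset.sum_congr rfl fun A _ => ?_
  rw [Finset.prod_mul_distrib, Finset.prod_const, Finset.prod_pow_eq_pow_sum, sm, map_pow]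

lemma coeff_VW {K : Type*} [Field K] (w : K) (n : ℕ) :
    coeff n (VW w (n + 1)) = ∑ x ∈ Om n, w⁻¹ ^ x.2.1.1.card * w ^ x.2.1.2.card := by
  rw [VW, Om, map_sum, Finset.sum_sigma]
  refine Finset.sum_congr rfl fun k _ => ?_
  rw [Finset.sum_sigma, prod_exp, prod_exp, Finset.sum_mul_sum, ← Finset.sum_product',
    Finset.mul_sum, Finset.sum_mul, map_sum]
  refine Finset.sum_congr rfl fun AB _ => ?_
  have e : X ^ k * (C (w⁻¹ ^ AB.1.card) * (X : PowerSeries K) ^ (sm AB.1) *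
      (C (w ^ AB.2.card) * X ^ (sm AB.2))) * OK K (k + 1) =
      C (w⁻¹ ^ AB.1.card * w ^ AB.2.card) * (X ^ (k + sm AB.1 + sm AB.2) * OK K (k + 1)) := by
    rw [map_mul]
    ring
  rw [e, coeff_C_mul, coeff_XOK]
  dsimp only
  rw [Finset.sum_const, nsmul_eq_mul]
  ring

end OB

namespace OB
open PowerSeries

def relL (a b : ℕ) : Prop := a ≤ b ∧ (a = b → Odd a)

instance : Trans relL relL relL where
  trans := by
    rintro a b c ⟨h1, h2⟩ ⟨h3, h4⟩
    refine ⟨h1.trans h3, fun h => h2 (by omega)⟩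

def ms (A : Finset ℕ) (M : Multiset ℕ) : Multiset ℕ := A.val.map (fun a => 2 * a + 2) + M

def mkL (A : Finset ℕ) (M : Multiset ℕ) : List ℕ := (ms A M).sort (· ≤ ·)

def SL (L : List ℕ) (p : ℕ) : Prop :=
  (∀ x ∈ L, 0 < x) ∧ L.IsChain relL ∧ ∀ x ∈ L, x < p

lemma mem_mkL {A : Finset ℕ} {M : Multiset ℕ} {x : ℕ} :
    x ∈ mkL A M ↔ (∃ a ∈ A, 2 * a + 2 = x) ∨ x ∈ M := by
  unfold mkL ms
  rw [Multiset.mem_sort, Multiset.mem_add, Multiset.mem_map]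
  rfl

lemma ms_filter_odd {A : Finset ℕ} {M : Multiset ℕ} (hM : ∀ x ∈ M, Odd x) :
    (ms A M).filter (fun x => x % 2 = 1) = M := by
  unfold ms
  rw [Multiset.filter_add, Multiset.filter_eq_nil.mpr, zero_add, Multiset.filter_eq_self.mpr]
  · intro x hx
    exact Nat.odd_iff.mp (hM x hx)
  · intro x hx
    obtain ⟨a, _, rfl⟩ := Multiset.mem_map.mp hx
    omega

lemma ms_filter_even {A : Finset ℕ} {M : Multiset ℕ} (hM : ∀ x ∈ M, Odd x) :
    (ms A M).filter (fun x => ¬ x % 2 = 1) = A.val.map (fun a => 2 * a + 2) := by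
  unfold ms
  rw [Multiset.filter_add, Multiset.filter_eq_self.mpr, Multiset.filter_eq_nil.mpr, add_zero]
  · intro x hx
    simpa using Nat.odd_iff.mp (hM x hx)
  · intro x hx
    obtain ⟨a, _, rfl⟩ := Multiset.mem_map.mp hx
    omega

lemma coe_mkL (A : Finset ℕ) (M : Multiset ℕ) : (mkL A M : Multiset ℕ) = ms A M :=
  Multiset.sort_eq _ _

lemma mkL_inj {A B : Finset ℕ} {M N : Multiset ℕ} (hM : ∀ x ∈ M, Odd x) (hN : ∀ x ∈ N, Odd x)
    (h : mkL A M = mkL B N) : A = B ∧ M = N := by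
  have h1 : ms A M = ms B N := by rw [← coe_mkL, ← coe_mkL, h]
  refine ⟨?_, ?_⟩
  · have h2 := congrArg (Multiset.filter (fun x => ¬ x % 2 = 1)) h1
    rw [ms_filter_even hM, ms_filter_even hN] at h2
    have hinj : Function.Injective (fun a : ℕ => 2 * a + 2) := fun a b h => by
      simp only at h; omega
    exact Finset.val_injective (Multiset.map_injective hinj h2)
  · rw [← ms_filter_odd (A := A) hM, h1, ms_filter_odd hN]

lemma mkL_length (A : Finset ℕ) (M : Multiset ℕ) : (mkL A M).length = A.card + M.card := by
  rw [mkL, Multiset.length_sort, ms, Multiset.card_add, Multiset.card_map]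
  rfl

lemma mkL_sum (A : Finset ℕ) (M : Multiset ℕ) : (mkL A M).sum = 2 * sm A + M.sum := by
  rw [← Multiset.sum_coe, coe_mkL, ms, Multiset.sum_add, sm, Finset.mul_sum]
  congr 1

lemma mkL_filter {A : Finset ℕ} {M : Multiset ℕ} (hM : ∀ x ∈ M, Odd x) :
    (((mkL A M).filter (fun x => x % 2 == 1) : List ℕ) : Multiset ℕ) = M := by
  have := ms_filter_odd (A := A) hM
  rw [← coe_mkL, Multiset.filter_coe] at this
  have e : (fun x : ℕ => x % 2 == 1) = (fun x => decide (x % 2 = 1)) := by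
    funext x
    exact beq_eq_decide _ _
  rw [e]
  exact this

lemma mkL_pairwise (A : Finset ℕ) (M : Multiset ℕ) : (mkL A M).Pairwise (· ≤ ·) :=
  Multiset.pairwise_sort _ _

lemma mkL_SL {A : Finset ℕ} {M : Multiset ℕ} {k : ℕ} (hA : A ⊆ Finset.range k)
    (hM : ∀ x ∈ M, Odd x ∧ x < 2 * (k + 1)) : SL (mkL A M) (2 * (k + 1)) := by
  refine ⟨?_, ?_, ?_⟩
  · intro x hx
    rcases mem_mkL.mp hx with ⟨a, _, rfl⟩ | h
    · omega
    · exact (hM x h).1.pos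
  · rw [List.isChain_iff_pairwise]
    refine (mkL_pairwise A M).and ?_
    rw [List.pairwise_iff_forall_sublist]
    intro a b hab h
    subst h
    by_contra hodd
    have h1 : 2 ≤ (mkL A M).count a := by
      have := hab.count_le a
      simpa using this
    rw [← Multiset.coe_count, coe_mkL, ms, Multiset.count_add,
      Multiset.count_eq_zero_of_notMem (fun h => hodd (hM a h).1), add_zero] at h1
    have hinj : Function.Injective (fun a : ℕ => 2 * a + 2) := fun a b h => by
      simp only at h; omega
    have := Multiset.nodup_iff_count_le_one.mp (A.nodup.map hinj) a
    omega
  · intro x hx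
    rcases mem_mkL.mp hx with ⟨a, ha, rfl⟩ | h
    · have := Finset.mem_range.mp (hA ha)
      omega
    · exact (hM x h).2

lemma SL_exists {L : List ℕ} {k : ℕ} (h : SL L (2 * (k + 1))) :
    ∃ A ⊆ Finset.range k, ∃ M : Multiset ℕ, (∀ x ∈ M, Odd x ∧ x < 2 * (k + 1)) ∧ L = mkL A M := by
  obtain ⟨h1, h2, h3⟩ := h
  rw [List.isChain_iff_pairwise] at h2
  refine ⟨(Finset.range k).filter (fun a => 2 * a + 2 ∈ L), Finset.filter_subset _ _,
    Multiset.filter (fun x => x % 2 = 1) (L : Multiset ℕ), ?_, ?_⟩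
  · intro x hx
    rw [Multiset.mem_filter] at hx
    exact ⟨Nat.odd_iff.mpr hx.2, h3 x (by simpa using hx.1)⟩
  · have hnd : (Multiset.filter (fun x => ¬ x % 2 = 1) (L : Multiset ℕ)).Nodup := by
      rw [Multiset.filter_coe, Multiset.coe_nodup]
      have h4 := h2.filter (fun x => decide (¬ x % 2 = 1))
      rw [List.Nodup]
      refine List.Pairwise.imp_of_mem ?_ h4
      intro a b ha hb hab e
      have h5 := Nat.odd_iff.mp (hab.2 e)
      have h6 := (List.mem_filter.mp ha).2
      simp [h5] at h6
    have hinj : Function.Injective (fun a : ℕ => 2 * a + 2) := fun a b h => by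
      simp only at h; omega
    have hE : ((Finset.range k).filter (fun a => 2 * a + 2 ∈ L)).val.map (fun a => 2 * a + 2) =
        Multiset.filter (fun x => ¬ x % 2 = 1) (L : Multiset ℕ) := by
      rw [Multiset.Nodup.ext (Multiset.Nodup.map hinj (Finset.nodup _)) hnd]
      intro x
      rw [Multiset.mem_map, Multiset.mem_filter, Multiset.mem_coe]
      constructor
      · rintro ⟨a, ha, rfl⟩
        have := (Finset.mem_filter.mp (Finset.mem_val.mp ha)).2
        exact ⟨this, by omega⟩
      · rintro ⟨hx, he⟩
        have p1 := h1 x hx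
        have p2 := h3 x hx
        have e : 2 * (x / 2 - 1) + 2 = x := by omega
        refine ⟨x / 2 - 1, Finset.mem_filter.mpr ⟨Finset.mem_range.mpr (by omega), ?_⟩, e⟩
        rw [e]; exact hx
    refine List.Perm.eq_of_pairwise (le := (· ≤ ·)) (fun a b _ _ h h' => le_antisymm h h')
      (h2.imp fun h => h.1) (mkL_pairwise _ _) ?_
    rw [← Multiset.coe_eq_coe, coe_mkL, ms, hE, add_comm, Multiset.filter_add_not]

lemma isOB_iff (L : List ℕ) (p : ℕ) (R : List ℕ) : IsOddBalanced L p R ↔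
    (Even p ∧ 0 < p) ∧ SL L p ∧ SL R.reverse p ∧
    L.filter (fun x => x % 2 == 1) = R.reverse.filter (fun x => x % 2 == 1) := by
  unfold IsOddBalanced SL
  have hc : R.reverse.IsChain relL ↔ R.IsChain (fun a b => b ≤ a ∧ (a = b → Odd a)) := by
    rw [List.isChain_reverse]
    have : (fun a b => relL b a) = (fun a b : ℕ => b ≤ a ∧ (a = b → Odd a)) := by
      ext a b
      unfold relL
      refine and_congr_right fun _ => ?_
      constructor
      · intro h e
        rw [e]; exact h e.symm
      · intro h e
        rw [e]; exact h e.symm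
    rw [this]
  rw [hc]
  simp only [List.mem_reverse]
  unfold relL
  tauto

/-- the bijection -/
def jj (x : Σ _ : ℕ, Σ _ : Finset ℕ × Finset ℕ, Multiset ℕ) : List ℕ × ℕ × List ℕ :=
  (mkL x.2.1.1 x.2.2, 2 * (x.1 + 1), (mkL x.2.1.2 x.2.2).reverse)

lemma mem_Om {n : ℕ} {x : Σ _ : ℕ, Σ _ : Finset ℕ × Finset ℕ, Multiset ℕ} : x ∈ Om n ↔
    x.2.1.1 ⊆ Finset.range x.1 ∧ x.2.1.2 ⊆ Finset.range x.1 ∧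
    x.2.2.sum + (x.1 + sm x.2.1.1 + sm x.2.1.2) = n ∧ ∀ y ∈ x.2.2, Odd y ∧ y < 2 * (x.1 + 1) := by
  unfold Om
  rw [Finset.mem_sigma, Finset.mem_sigma, Finset.mem_product, Finset.mem_powerset,
    Finset.mem_powerset, mem_RS, Finset.mem_range]
  constructor
  · rintro ⟨_, ⟨h1, h2⟩, h3, h4⟩
    exact ⟨h1, h2, h3, h4⟩
  · rintro ⟨h1, h2, h3, h4⟩
    exact ⟨by omega, ⟨h1, h2⟩, h3, h4⟩

def XX (n : ℕ) : Set (List ℕ × ℕ × List ℕ) :=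
  {x | IsOddBalanced x.1 x.2.1 x.2.2 ∧ x.1.sum + x.2.1 + x.2.2.sum = 2 * n + 2}

lemma jj_mem {n : ℕ} {x} (hx : x ∈ Om n) : jj x ∈ XX n := by
  obtain ⟨h1, h2, h3, h4⟩ := mem_Om.mp hx
  refine ⟨?_, ?_⟩
  · rw [isOB_iff]
    refine ⟨⟨even_two_mul _, by simp [jj]⟩, mkL_SL h1 h4, ?_, ?_⟩
    · simp only [jj, List.reverse_reverse]
      exact mkL_SL h2 h4
    · simp only [jj, List.reverse_reverse]
      refine List.Perm.eq_of_pairwise (le := (· ≤ ·)) (fun a b _ _ h h' => le_antisymm h h')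
        ((mkL_pairwise _ _).filter _) ((mkL_pairwise _ _).filter _) ?_
      rw [← Multiset.coe_eq_coe, mkL_filter fun y hy => (h4 y hy).1,
        mkL_filter fun y hy => (h4 y hy).1]
  · simp only [jj, List.sum_reverse, mkL_sum]
    omega

lemma jj_inj (n : ℕ) : Set.InjOn jj (Om n : Set _) := by
  rintro ⟨k, ⟨A, B⟩, M⟩ hx ⟨k', ⟨A', B'⟩, M'⟩ hx' h
  obtain ⟨h1, h2, h3, h4⟩ := mem_Om.mp hx
  obtain ⟨h1', h2', h3', h4'⟩ := mem_Om.mp hx'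
  simp only [jj, Prod.mk.injEq, List.reverse_inj] at h
  obtain ⟨e1, e2, e3⟩ := h
  obtain ⟨rfl, rfl⟩ := mkL_inj (fun y hy => (h4 y hy).1) (fun y hy => (h4' y hy).1) e1
  obtain ⟨rfl, _⟩ := mkL_inj (fun y hy => (h4 y hy).1) (fun y hy => (h4' y hy).1) e3
  have : k = k' := by omega
  subst this
  rfl

lemma jj_surj {n : ℕ} {y} (hy : y ∈ XX n) : ∃ x ∈ Om n, jj x = y := by
  obtain ⟨L, p, R⟩ := y
  obtain ⟨h1, h2⟩ := hy
  rw [isOB_iff] at h1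
  obtain ⟨⟨he, hp⟩, hL, hR, hf⟩ := h1
  simp only at he hp hL hR hf h2
  obtain ⟨q, hq⟩ := he
  obtain ⟨k, hk⟩ : ∃ k, p = 2 * (k + 1) := ⟨q - 1, by omega⟩
  subst hk
  obtain ⟨A, hA, M, hM, rfl⟩ := SL_exists hL
  obtain ⟨B, hB, N, hN, hR'⟩ := SL_exists hR
  rw [hR'] at hf
  have hMN : M = N := by
    rw [← mkL_filter (A := A) fun y hy => (hM y hy).1, hf, mkL_filter fun y hy => (hN y hy).1]
  subst hMN
  have hR2 : R = (mkL B M).reverse := by rw [← hR', List.reverse_reverse]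
  refine ⟨⟨k, (A, B), M⟩, ?_, ?_⟩
  · refine mem_Om.mpr ⟨hA, hB, ?_, hM⟩
    rw [hR2, List.sum_reverse, mkL_sum, mkL_sum] at h2
    dsimp only
    omega
  · simp only [jj, hR2]

lemma jj_image (n : ℕ) : jj '' (Om n : Set _) = XX n := by
  ext y
  constructor
  · rintro ⟨x, hx, rfl⟩
    exact jj_mem hx
  · intro hy
    obtain ⟨x, hx, e⟩ := jj_surj hy
    exact ⟨x, hx, e⟩

def rk (x : Σ _ : ℕ, Σ _ : Finset ℕ × Finset ℕ, Multiset ℕ) : ℤ :=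
  (x.2.1.2.card : ℤ) - x.2.1.1.card

lemma rk_jj (x) : (((jj x).2.2.length : ℤ) - ((jj x).1.length : ℤ)) = rk x := by
  simp only [jj, List.length_reverse, mkL_length, rk]
  push_cast
  ring

lemma count_eq (a : ℤ) (c n : ℕ) :
    oddBalancedCountMod a c n = ((Om n).filter (fun x => rk x ≡ a [ZMOD (c : ℤ)])).card := by
  unfold oddBalancedCountMod
  rw [← Set.ncard_coe_finset, ← Set.ncard_image_of_injOn
    ((jj_inj n).mono (by intro x hx; exact Finset.mem_of_mem_filter x hx))]
  change Set.ncard {x : List ℕ × ℕ × List ℕ | _} = _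
  congr 1
  ext y
  simp only [Set.mem_setOf_eq, Set.mem_image, Finset.coe_filter]
  constructor
  · rintro ⟨h1, h2, h3⟩
    obtain ⟨x, hx, rfl⟩ := jj_surj (n := n) ⟨h1, h2⟩
    rw [rk_jj] at h3
    exact ⟨x, ⟨hx, h3⟩, rfl⟩
  · rintro ⟨x, ⟨hx, h3⟩, rfl⟩
    obtain ⟨h1, h2⟩ := jj_mem hx
    rw [rk_jj]
    exact ⟨h1, h2, h3⟩

lemma sum_rk {K : Type*} [Field K] {w : K} (hw : w ≠ 0) (n : ℕ) :
    ∑ x ∈ Om n, w ^ rk x = coeff n (VW w (n + 1)) := by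
  rw [coeff_VW]
  refine Finset.sum_congr rfl fun x _ => ?_
  rw [rk, zpow_sub₀ hw, zpow_natCast, zpow_natCast, inv_pow, div_eq_mul_inv, mul_comm]

lemma VW_one (N : ℕ) : VW (1 : ℝ) N = VN 1 N := by
  unfold VW VN Un Dn On OK
  refine Finset.sum_congr rfl fun k _ => ?_
  simp only [inv_one, map_one, one_mul]
  ring

lemma card_Om (n : ℕ) : ((Om n).card : ℝ) = vt n := by
  have := sum_rk (K := ℝ) one_ne_zero n
  simp only [one_zpow, Finset.sum_const, nsmul_eq_mul, mul_one] at this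
  rw [this, VW_one, vt]

end OB

namespace OB
open PowerSeries

lemma prod_range_mono {f : ℕ → ℝ} (hf : ∀ j, 1 ≤ f j) {k N : ℕ} (h : k ≤ N) :
    ∏ j ∈ Finset.range k, f j ≤ ∏ j ∈ Finset.range N, f j := by
  refine monotone_nat_of_le_succ (f := fun k => ∏ j ∈ Finset.range k, f j) (fun n => ?_) h
  simp only [Finset.prod_range_succ]
  exact le_mul_of_one_le_right
    (Finset.prod_nonneg fun j _ => zero_le_one.trans (hf j)) (hf n)

/-- majorant -/
def Mj (f : PowerSeries ℂ) (g : PowerSeries ℝ) : Prop := ∀ n, ‖coeff n f‖ ≤ coeff n g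

lemma Mj.add {f f' : PowerSeries ℂ} {g g' : PowerSeries ℝ} (h : Mj f g) (h' : Mj f' g') :
    Mj (f + f') (g + g') := fun n => by
  rw [map_add, map_add]
  exact (norm_add_le _ _).trans (add_le_add (h n) (h' n))

lemma Mj.mul {f f' : PowerSeries ℂ} {g g' : PowerSeries ℝ} (h : Mj f g) (h' : Mj f' g') :
    Mj (f * f') (g * g') := fun n => by
  rw [coeff_mul, coeff_mul]
  refine (norm_sum_le _ _).trans (Finset.sum_le_sum fun p _ => ?_)
  rw [norm_mul]
  exact mul_le_mul (h _) (h' _) (norm_nonneg _) ((norm_nonneg _).trans (h _))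

lemma Mj.X_pow (k : ℕ) : Mj (X ^ k) (X ^ k) := fun n => by
  rw [coeff_X_pow, coeff_X_pow]
  split_ifs <;> simp

lemma Mj.one : Mj 1 1 := by simpa using Mj.X_pow 0

lemma Mj.C {a : ℂ} {b : ℝ} (h : ‖a‖ ≤ b) : Mj (C a) (C b) := fun n => by
  rw [coeff_C, coeff_C]
  split_ifs
  · exact h
  · simp

lemma Mj.gInv (k : ℕ) : Mj (gInv ℂ k) (gInv ℝ k) := fun n => by
  rw [OB.gInv, OB.gInv, coeff_mk, coeff_mk]
  split_ifs <;> simp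

lemma Mj.prod {ι : Type*} (s : Finset ι) {f : ι → PowerSeries ℂ} {g : ι → PowerSeries ℝ}
    (h : ∀ i ∈ s, Mj (f i) (g i)) : Mj (∏ i ∈ s, f i) (∏ i ∈ s, g i) := by
  classical
  induction s using Finset.induction_on with
  | empty => simpa using Mj.one
  | insert a s ha ih =>
    rw [Finset.prod_insert ha, Finset.prod_insert ha]
    exact (h a (Finset.mem_insert_self _ _)).mul (ih fun i hi => h i (Finset.mem_insert_of_mem hi))

lemma Mj.sum {ι : Type*} (s : Finset ι) {f : ι → PowerSeries ℂ} {g : ι → PowerSeries ℝ}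
    (h : ∀ i ∈ s, Mj (f i) (g i)) : Mj (∑ i ∈ s, f i) (∑ i ∈ s, g i) := by
  classical
  induction s using Finset.induction_on with
  | empty => intro n; simp
  | insert a s ha ih =>
    rw [Finset.sum_insert ha, Finset.sum_insert ha]
    exact (h a (Finset.mem_insert_self _ _)).add (ih fun i hi => h i (Finset.mem_insert_of_mem hi))

/-- the majorant of `VW` -/
def WK (κ : ℝ) (N : ℕ) : PowerSeries ℝ :=
  ∑ k ∈ Finset.range N, X ^ k * (∏ j ∈ Finset.range k,
    (1 + C (2 * κ) * X ^ (j + 1) + X ^ (2 * (j + 1)))) * On (k + 1)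

lemma VW_Mj {w : ℂ} (hw : ‖w‖ = 1) (N : ℕ) : Mj (VW w N) (WK |w.re| N) := by
  refine Mj.sum _ fun k _ => ((Mj.X_pow k).mul ?_).mul (Mj.prod _ fun i _ => Mj.gInv _)
  rw [← Finset.prod_mul_distrib]
  refine Mj.prod _ fun j _ => ?_
  have hw0 : w ≠ 0 := by rw [← norm_pos_iff, hw]; norm_num
  have e2 : w⁻¹ + w = ((2 * w.re : ℝ) : ℂ) := by
    rw [Complex.inv_eq_conj hw, add_comm, Complex.add_conj]
  have e : (1 + C w⁻¹ * (X : PowerSeries ℂ) ^ (j + 1)) * (1 + C w * X ^ (j + 1)) =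
      1 + C (((2 * w.re : ℝ) : ℂ)) * X ^ (j + 1) + X ^ (2 * (j + 1)) := by
    rw [← e2, map_add]
    have e3 : C w⁻¹ * C w = (1 : PowerSeries ℂ) := by
      rw [← map_mul, inv_mul_cancel₀ hw0, map_one]
    linear_combination (X : PowerSeries ℂ) ^ (2 * (j + 1)) * e3
  rw [e]
  refine (Mj.one.add ((Mj.C ?_).mul (Mj.X_pow _))).add (Mj.X_pow _)
  rw [Complex.norm_real, Real.norm_eq_abs, abs_mul, abs_two]

lemma NN_WK {κ : ℝ} (h : 0 ≤ κ) (N : ℕ) : NN (WK κ N) :=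
  NN.sum _ fun k _ => ((NN.X_pow k).mul (NN.prod _ fun j _ =>
    (NN.one.add ((NN.C (by positivity)).mul (NN.X_pow _))).add (NN.X_pow _))).mul
      (NN.prod _ fun i _ => NN.gInv _)

lemma Ev_WK (κ : ℝ) {r : ℝ} (hr0 : 0 ≤ r) (hr1 : r < 1) (N : ℕ) : Ev (WK κ N) r
    (∑ k ∈ Finset.range N, r ^ k * (∏ j ∈ Finset.range k,
      (1 + 2 * κ * r ^ (j + 1) + r ^ (2 * (j + 1)))) *
        ∏ i ∈ Finset.range (k + 1), (1 - r ^ (2 * i + 1))⁻¹) := by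
  have hr : ‖r‖ < 1 := by rwa [Real.norm_of_nonneg hr0]
  refine Ev.sum _ fun k _ => ((Ev.X_pow k r).mul (Ev.prod _ fun j _ =>
    ((Ev.one r).add ?_).add (Ev.X_pow _ r))).mul (Ev.prod _ fun i _ => Ev.gInv hr (Nat.succ_pos _))
  exact Ev.C_mul_X_pow (K := ℝ) (2 * κ) (j + 1) r

lemma tele_prod {r : ℝ} (hr0 : 0 ≤ r) (hr1 : r < 1) (N : ℕ) :
    ∏ j ∈ Finset.range N, ((1 - r ^ (2 * j + 2)) * (1 - r ^ (2 * j + 1))⁻¹) ≤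
      (1 - r ^ (2 * N + 1)) * (1 - r)⁻¹ := by
  have hp : ∀ k : ℕ, 0 < 1 - r ^ (k + 1) := fun k =>
    sub_pos.mpr (pow_lt_one₀ hr0 hr1 (Nat.succ_ne_zero k))
  induction N with
  | zero =>
    have : 0 < 1 - r := by linarith
    simp only [Finset.prod_range_zero, mul_zero, zero_add, pow_one]
    rw [mul_inv_cancel₀ this.ne']
  | succ N ih =>
    rw [Finset.prod_range_succ]
    have h1 := hp (2 * N)
    have h2 := hp (2 * N + 1)
    have h3 : r ^ (2 * (N + 1) + 1) ≤ r ^ (2 * N + 2) :=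
      pow_le_pow_of_le_one hr0 hr1.le (by omega)
    have h4 : 0 < (1 - r)⁻¹ := inv_pos.mpr (by linarith)
    calc _ ≤ (1 - r ^ (2 * N + 1)) * (1 - r)⁻¹ *
          ((1 - r ^ (2 * N + 2)) * (1 - r ^ (2 * N + 1))⁻¹) := by
            apply mul_le_mul_of_nonneg_right ih
            exact mul_nonneg h2.le (inv_nonneg.mpr h1.le)
      _ = (1 - r ^ (2 * N + 2)) * (1 - r)⁻¹ := by
            field_simp
      _ ≤ _ := by
            apply mul_le_mul_of_nonneg_right _ h4.le
            linarith

lemma fac_le {κ x : ℝ} (hκ0 : 0 ≤ κ) (hκ : κ < 1) (hx0 : 0 ≤ x) (hx1 : x ≤ 1) :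
    1 + 2 * κ * x + x ^ 2 ≤ (1 + x) ^ 2 * rexp (-((1 - κ) / 2 * x)) := by
  have h1 : 1 - (1 - κ) / 2 * x ≤ rexp (-((1 - κ) / 2 * x)) := by
    have := Real.add_one_le_exp (-((1 - κ) / 2 * x))
    linarith
  have h2 : (1 + x) ^ 2 * (1 - (1 - κ) / 2 * x) ≤ (1 + x) ^ 2 * rexp (-((1 - κ) / 2 * x)) :=
    mul_le_mul_of_nonneg_left h1 (sq_nonneg _)
  refine le_trans ?_ h2
  have h3 : (1 + x) ^ 2 ≤ 4 := by nlinarith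
  have h4 : 0 ≤ (1 - κ) * x := mul_nonneg (by linarith) hx0
  nlinarith

lemma value_le {κ r : ℝ} (hκ0 : 0 ≤ κ) (hκ : κ < 1) (hr0 : 0 ≤ r) (hr1 : r < 1) (N : ℕ) :
    (∑ k ∈ Finset.range N, r ^ k * (∏ j ∈ Finset.range k,
      (1 + 2 * κ * r ^ (j + 1) + r ^ (2 * (j + 1)))) *
        ∏ i ∈ Finset.range (k + 1), (1 - r ^ (2 * i + 1))⁻¹) ≤
    N * (rexp (-((1 - κ) / 2 * ∑ j ∈ Finset.range N, r ^ (j + 1))) * (PBr r * (1 - r)⁻¹)) := by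
  have hp : ∀ k : ℕ, 0 < 1 - r ^ (k + 1) := fun k =>
    sub_pos.mpr (pow_lt_one₀ hr0 hr1 (Nat.succ_ne_zero k))
  have hpw : ∀ k : ℕ, 0 ≤ r ^ k := fun k => pow_nonneg hr0 k
  have hpl : ∀ k : ℕ, r ^ k ≤ 1 := fun k => pow_le_one₀ hr0 hr1.le
  have f1 : ∀ j : ℕ, 1 ≤ 1 + 2 * κ * r ^ (j + 1) + r ^ (2 * (j + 1)) := fun j => by
    have h1 := hpw (j + 1)
    have h2 := hpw (2 * (j + 1))
    have := mul_nonneg hκ0 h1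
    linarith
  have f2 : ∀ i : ℕ, 1 ≤ (1 - r ^ (2 * i + 1))⁻¹ := fun i =>
    (one_le_inv₀ (hp _)).mpr (by linarith [hpw (2 * i + 1)])
  set P := ∏ j ∈ Finset.range N, (1 + 2 * κ * r ^ (j + 1) + r ^ (2 * (j + 1))) with hP
  set Q := ∏ i ∈ Finset.range N, (1 - r ^ (2 * i + 1))⁻¹ with hQ
  have hP0 : 0 ≤ P := Finset.prod_nonneg fun j _ => by linarith [f1 j]
  have hQ0 : 0 ≤ Q := Finset.prod_nonneg fun j _ => by linarith [f2 j]
  have step1 : (∑ k ∈ Finset.range N, r ^ k * (∏ j ∈ Finset.range k,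
      (1 + 2 * κ * r ^ (j + 1) + r ^ (2 * (j + 1)))) *
        ∏ i ∈ Finset.range (k + 1), (1 - r ^ (2 * i + 1))⁻¹) ≤ N * (P * Q) := by
    rw [← nsmul_eq_mul]
    refine (Finset.sum_le_card_nsmul _ _ (P * Q) ?_).trans (by rw [Finset.card_range])
    intro k hk
    have hkN := Finset.mem_range.mp hk
    have g1 : ∏ j ∈ Finset.range k, (1 + 2 * κ * r ^ (j + 1) + r ^ (2 * (j + 1))) ≤ P := prod_range_mono f1 hkN.le
    have g2 : ∏ i ∈ Finset.range (k + 1), (1 - r ^ (2 * i + 1))⁻¹ ≤ Q := prod_range_mono f2 hkN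
    have g3 : 0 ≤ ∏ j ∈ Finset.range k, (1 + 2 * κ * r ^ (j + 1) + r ^ (2 * (j + 1))) :=
      Finset.prod_nonneg fun j _ => by linarith [f1 j]
    have g4 : 0 ≤ ∏ i ∈ Finset.range (k + 1), (1 - r ^ (2 * i + 1))⁻¹ :=
      Finset.prod_nonneg fun j _ => by linarith [f2 j]
    refine mul_le_mul ?_ g2 g4 hP0
    calc _ ≤ 1 * ∏ j ∈ Finset.range k, (1 + 2 * κ * r ^ (j + 1) + r ^ (2 * (j + 1))) :=
          mul_le_mul_of_nonneg_right (hpl k) g3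
      _ ≤ P := by rw [one_mul]; exact g1
  refine step1.trans (mul_le_mul_of_nonneg_left ?_ (Nat.cast_nonneg N))
  have step2 : P ≤ (∏ j ∈ Finset.range N, (1 + r ^ (j + 1)) ^ 2) *
      rexp (-((1 - κ) / 2 * ∑ j ∈ Finset.range N, r ^ (j + 1))) := by
    rw [Finset.mul_sum, ← Finset.sum_neg_distrib, Real.exp_sum, ← Finset.prod_mul_distrib]
    refine Finset.prod_le_prod (fun j _ => by linarith [f1 j]) fun j _ => ?_
    have := fac_le hκ0 hκ (hpw (j + 1)) (hpl (j + 1))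
    rwa [← pow_mul, mul_comm (j + 1) 2] at this
  have step3 : (∏ j ∈ Finset.range N, (1 + r ^ (j + 1)) ^ 2) * Q ≤ PBr r * (1 - r)⁻¹ := by
    have e : (∏ j ∈ Finset.range N, (1 + r ^ (j + 1)) ^ 2) * Q =
        (∏ j ∈ Finset.range N, ((1 + r ^ (j + 1)) * (1 - r ^ (j + 1))⁻¹)) *
        ∏ j ∈ Finset.range N, ((1 - r ^ (2 * j + 2)) * (1 - r ^ (2 * j + 1))⁻¹) := by
      rw [hQ, ← Finset.prod_mul_distrib, ← Finset.prod_mul_distrib]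
      refine Finset.prod_congr rfl fun j _ => ?_
      have h1 := (hp j).ne'
      have h2 := (hp (2 * j)).ne'
      rw [show r ^ (2 * j + 2) = (r ^ (j + 1)) ^ 2 by ring]
      field_simp
      ring
    rw [e]
    have hN : 0 ≤ ∏ j ∈ Finset.range N, ((1 - r ^ (2 * j + 2)) * (1 - r ^ (2 * j + 1))⁻¹) :=
      Finset.prod_nonneg fun j _ =>
        mul_nonneg (hp (2 * j + 1)).le (inv_nonneg.mpr (hp (2 * j)).le)
    refine mul_le_mul (PBr_ge_one hr0 hr1 N) ?_ hN (PBr_nonneg hr0)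
    refine (tele_prod hr0 hr1 N).trans ?_
    have : 0 ≤ (1 - r)⁻¹ := inv_nonneg.mpr (by linarith)
    nlinarith [hpw (2 * N + 1)]
  calc P * Q ≤ (∏ j ∈ Finset.range N, (1 + r ^ (j + 1)) ^ 2) *
      rexp (-((1 - κ) / 2 * ∑ j ∈ Finset.range N, r ^ (j + 1))) * Q :=
        mul_le_mul_of_nonneg_right step2 hQ0
    _ = rexp (-((1 - κ) / 2 * ∑ j ∈ Finset.range N, r ^ (j + 1))) *
        ((∏ j ∈ Finset.range N, (1 + r ^ (j + 1)) ^ 2) * Q) := by ring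
    _ ≤ _ := mul_le_mul_of_nonneg_left step3 (Real.exp_pos _).le

lemma coeff_bound {w : ℂ} (hw : ‖w‖ = 1) (hκ : |w.re| < 1) {r : ℝ} (hr0 : 0 ≤ r) (hr1 : r < 1)
    (n : ℕ) : ‖coeff n (VW w (n + 1))‖ * r ^ n ≤ ((n + 1 : ℕ) : ℝ) *
      (rexp (-((1 - |w.re|) / 2 * ∑ j ∈ Finset.range (n + 1), r ^ (j + 1))) * (PBr r * (1 - r)⁻¹)) := by
  have h1 := VW_Mj hw (n + 1) n
  have h2 := (Ev_WK |w.re| hr0 hr1 (n + 1)).coeff_le hr0 (NN_WK (abs_nonneg _) _) n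
  have h3 := value_le (abs_nonneg w.re) hκ hr0 hr1 (n + 1)
  exact (mul_le_mul_of_nonneg_right h1 (pow_nonneg hr0 n)).trans (h2.trans h3)

lemma sum_pow_ge {t : ℝ} (h0 : 0 < t) (h1 : t ≤ 1 / 2) {n : ℕ} (hn : 1 ≤ t * n) :
    1 / (4 * t) ≤ ∑ j ∈ Finset.range (n + 1), rexp (-t) ^ (j + 1) := by
  set r := rexp (-t) with hr
  have hr2 : 1 / 2 ≤ r := by
    have := Real.add_one_le_exp (-t)
    linarith
  have hr1 : r < 1 := by rw [hr, Real.exp_lt_one_iff]; linarith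
  have hrt : 1 - r ≤ t := by
    have := Real.add_one_le_exp (-t)
    linarith
  have hrn : r ^ (n + 1) ≤ 1 / 2 := by
    have h2 : r ^ (n + 1) ≤ r ^ n := pow_le_pow_of_le_one (by linarith) hr1.le (by omega)
    have h3 : r ^ n = rexp (-(t * n)) := by
      rw [hr, ← Real.exp_nat_mul]; congr 1; ring
    have h4 : rexp (-(t * n)) ≤ rexp (-1) := Real.exp_le_exp.mpr (by linarith)
    have h5 : rexp (-1) ≤ 1 / 2 := by
      rw [Real.exp_neg, inv_le_comm₀ (Real.exp_pos _) (by norm_num)]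
      have := Real.add_one_le_exp 1
      norm_num
      linarith
    linarith
  have e : ∑ j ∈ Finset.range (n + 1), r ^ (j + 1) = r * ((1 - r ^ (n + 1)) / (1 - r)) := by
    have h6 : ∑ j ∈ Finset.range (n + 1), r ^ (j + 1) = r * ∑ j ∈ Finset.range (n + 1), r ^ j := by
      rw [Finset.mul_sum]
      exact Finset.sum_congr rfl fun j _ => pow_succ' r j
    rw [h6, geom_sum_eq hr1.ne, ← neg_sub (1 : ℝ) r, ← neg_sub (1 : ℝ) (r ^ (n + 1)), neg_div_neg_eq]
  rw [e]
  have h7 : (1 / 2) / t ≤ (1 - r ^ (n + 1)) / (1 - r) := by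
    apply div_le_div₀ <;> linarith
  calc 1 / (4 * t) = 1 / 2 * ((1 / 2) / t) := by field_simp; norm_num
    _ ≤ _ := mul_le_mul hr2 h7 (by positivity) (by linarith)

theorem VW_small {w : ℂ} (hw : ‖w‖ = 1) (hκ : |w.re| < 1) :
    Tendsto (fun n => ‖coeff n (VW w (n + 1))‖ / ff n) atTop (𝓝 0) := by
  set δ : ℝ := (1 - |w.re|) / 2 with hδ
  have hδ0 : 0 < δ := by rw [hδ]; linarith
  have hlim : Tendsto (fun t : ℝ => 4 * π ^ 4 * ((t⁻¹) ^ 5 * rexp (-(δ / 4 * t⁻¹)))) (𝓝[>] 0) (𝓝 0) := by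
    have h1 : Tendsto (fun x : ℝ => x ^ 5 * rexp (-(δ / 4 * x))) atTop (𝓝 0) := by
      have h2 := ((Real.tendsto_pow_mul_exp_neg_atTop_nhds_zero 5).comp
        (tendsto_id.const_mul_atTop (show (0 : ℝ) < δ / 4 by positivity))).const_mul ((δ / 4)⁻¹ ^ 5)
      rw [mul_zero] at h2
      refine h2.congr fun x => ?_
      simp only [Function.comp, id]
      field_simp
    have h3 := (h1.comp tendsto_inv_nhdsGT_zero).const_mul (4 * π ^ 4)
    rw [mul_zero] at h3
    exact h3
  refine tendsto_of_tendsto_of_tendsto_of_le_of_le' tendsto_const_nhds (hlim.comp tendsto_tt) ?_ ?_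
  · filter_upwards [ff_pos_ev] with n hn
    positivity
  · have htn : ∀ᶠ n : ℕ in atTop, 1 ≤ tt n * n := by
      filter_upwards [eventually_ge_atTop 1] with n hn
      have ha := aa_ge_one hn
      rw [← aa_four n, tt]
      have : π / (2 * aa n ^ 2) * aa n ^ 4 = π / 2 * aa n ^ 2 := by field_simp
      rw [this]
      nlinarith [Real.pi_gt_three]
    filter_upwards [ff_pos_ev, Qn_low, tendsto_tt.eventually eventually_good, htn,
      eventually_ge_atTop 1] with n hf hQ hg ht1 hn
    set t := tt n with htdef
    have ht0 := hg.1
    have ht2 := hg.2.1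
    set r := rexp (-t) with hr
    have hr0 : 0 < r := Real.exp_pos _
    have hr1 : r < 1 := by rw [hr, Real.exp_lt_one_iff]; linarith
    have hb := coeff_bound hw hκ hr0.le hr1 n
    rw [← hδ] at hb
    have hS := sum_pow_ge ht0 ht2 ht1
    have hinv : (1 - r)⁻¹ ≤ 2 / t := by
      rw [inv_le_comm₀ (by linarith) (by positivity), inv_div]
      have h1 : r ≤ (1 + t)⁻¹ := by
        rw [hr, Real.exp_neg]
        apply inv_anti₀ (by linarith)
        linarith [Real.add_one_le_exp t]
      have h2 : (1 + t)⁻¹ ≤ 1 - t / 2 := by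
        rw [inv_le_iff_one_le_mul₀ (by linarith)]
        nlinarith
      linarith
    have hE : rexp (-(δ * ∑ j ∈ Finset.range (n + 1), r ^ (j + 1))) ≤ rexp (-(δ / 4 * t⁻¹)) := by
      apply Real.exp_le_exp.mpr
      have := mul_le_mul_of_nonneg_left hS hδ0.le
      have e : δ * (1 / (4 * t)) = δ / 4 * t⁻¹ := by field_simp
      linarith
    set A := rexp (π ^ 2 / (4 * t)) with hA
    have hA0 : 0 < A := Real.exp_pos _
    have hsq : √t ≤ 1 := Real.sqrt_le_one.mpr (by linarith)
    have hPB : PBr r ≤ A := hg.PBr_le.trans (by nlinarith)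
    have hn1 : ((n + 1 : ℕ) : ℝ) ≤ π ^ 2 / (2 * t ^ 2) := by
      have h1 := tt_n hn
      rw [← htdef] at h1
      have h2 : π ^ 2 / (2 * t ^ 2) = 2 * (π ^ 2 / (4 * t ^ 2)) := by field_simp; norm_num
      rw [h2, h1]
      have : (1 : ℝ) ≤ n := by exact_mod_cast hn
      push_cast
      linarith
    set E := rexp (-(δ / 4 * t⁻¹)) with hEdef
    have hup : ‖coeff n (VW w (n + 1))‖ * r ^ n ≤ π ^ 2 / (2 * t ^ 2) * (E * (A * (2 / t))) := by
      refine hb.trans ?_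
      have hi0 : 0 ≤ (1 - r)⁻¹ := inv_nonneg.mpr (by linarith)
      have hp0 := PBr_nonneg hr0.le
      gcongr
    have hlow : t ^ 2 * A / (4 * π ^ 2) ≤ ff n * r ^ n := by
      rw [Qn, ← hr, Real.exp_neg, ← hA] at hQ
      have h1 : t ^ 2 * A / (4 * π ^ 2) ≤ pb n * r ^ n := by
        have h2 := mul_le_mul_of_nonneg_right hQ (show 0 ≤ t ^ 2 * A by positivity)
        have e1 : pb n * r ^ n * (A⁻¹ / t ^ 2) * (t ^ 2 * A) = pb n * r ^ n := by field_simp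
        have e2 : 1 / (4 * π ^ 2) * (t ^ 2 * A) = t ^ 2 * A / (4 * π ^ 2) := by ring
        rw [e1, e2] at h2
        exact h2
      refine h1.trans ?_
      rw [ff]
      have := aa_ge_one hn
      have h3 : 0 ≤ pb n * r ^ n := mul_nonneg (pb_nonneg n) (by positivity)
      nlinarith
    simp only [Function.comp]
    rw [← htdef, ← hEdef, div_le_iff₀ hf]
    have hrn : 0 < r ^ n := by positivity
    refine le_of_mul_le_mul_right (hup.trans ?_) hrn
    have hE0 : 0 < E := Real.exp_pos _
    calc π ^ 2 / (2 * t ^ 2) * (E * (A * (2 / t))) =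
        4 * π ^ 4 * (t⁻¹ ^ 5 * E) * (t ^ 2 * A / (4 * π ^ 2)) := by field_simp
      _ ≤ 4 * π ^ 4 * (t⁻¹ ^ 5 * E) * (ff n * r ^ n) :=
        mul_le_mul_of_nonneg_left hlow (by positivity)
      _ = _ := by ring

end OB

namespace OB
open PowerSeries

lemma geom_root {c : ℕ} {z : ℂ} (hz : z ^ c = 1) :
    ∑ j ∈ Finset.range c, z ^ j = if z = 1 then (c : ℂ) else 0 := by
  split_ifs with h
  · simp [h]
  · rw [geom_sum_eq h, hz, sub_self, zero_div]

lemma abs_re_lt_one {w : ℂ} (hw : ‖w‖ = 1) (h1 : w ≠ 1) (h2 : w ≠ -1) : |w.re| < 1 := by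
  have hsq : w.re ^ 2 + w.im ^ 2 = 1 := by
    have := Complex.sq_norm w
    rw [hw, Complex.normSq_apply] at this
    nlinarith
  have him : w.im ≠ 0 := by
    intro h0
    rw [h0] at hsq
    have : (w.re - 1) * (w.re + 1) = 0 := by nlinarith
    rcases mul_eq_zero.mp this with h | h
    · exact h1 (Complex.ext (by simp; linarith) (by simpa using h0))
    · exact h2 (Complex.ext (by simp; linarith) (by simpa using h0))
  have : 0 < w.im ^ 2 := by positivity
  rw [← sq_lt_one_iff_abs_lt_one]
  linarith

lemma root_props {c : ℕ} (hcodd : Odd c) {ζ : ℂ} (hζ : IsPrimitiveRoot ζ c) {j : ℕ}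
    (hj : j ∈ Finset.Ico 1 c) : ‖ζ ^ j‖ = 1 ∧ |(ζ ^ j).re| < 1 := by
  obtain ⟨hj1, hjc⟩ := Finset.mem_Ico.mp hj
  have hc0 : c ≠ 0 := by omega
  have hpow : (ζ ^ j) ^ c = 1 := by rw [← pow_mul, mul_comm, pow_mul, hζ.pow_eq_one, one_pow]
  have hn : ‖ζ ^ j‖ = 1 := Complex.norm_eq_one_of_pow_eq_one hpow hc0
  refine ⟨hn, abs_re_lt_one hn (hζ.pow_ne_one_of_pos_of_lt (by omega) hjc) ?_⟩
  intro h
  rw [h, hcodd.neg_one_pow] at hpow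
  norm_num at hpow

lemma count_sum (a : ℤ) {c : ℕ} (hc0 : c ≠ 0) {ζ : ℂ} (hζ : IsPrimitiveRoot ζ c) (n : ℕ) :
    (c : ℂ) * (oddBalancedCountMod a c n : ℂ) =
      ∑ j ∈ Finset.range c, (ζ ^ (-a)) ^ j * coeff n (VW (ζ ^ j) (n + 1)) := by
  have hz0 : ζ ≠ 0 := hζ.ne_zero hc0
  have e1 : ∀ j ∈ Finset.range c, (ζ ^ (-a)) ^ j * coeff n (VW (ζ ^ j) (n + 1)) =
      ∑ x ∈ Om n, (ζ ^ (rk x - a)) ^ j := by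
    intro j _
    rw [← sum_rk (pow_ne_zero j hz0), Finset.mul_sum]
    refine Finset.sum_congr rfl fun x _ => ?_
    rw [sub_eq_neg_add, zpow_add₀ hz0, mul_pow]
    congr 1
    rw [← zpow_natCast, ← zpow_natCast, ← zpow_mul, ← zpow_mul, mul_comm]
  rw [Finset.sum_congr rfl e1, Finset.sum_comm]
  have e2 : ∀ x ∈ Om n, ∑ j ∈ Finset.range c, (ζ ^ (rk x - a)) ^ j =
      if rk x ≡ a [ZMOD (c : ℤ)] then (c : ℂ) else 0 := by
    intro x _
    rw [geom_root]
    · congr 1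
      rw [hζ.zpow_eq_one_iff_dvd, Int.modEq_comm, Int.modEq_iff_dvd]
    · rw [← zpow_natCast, ← zpow_mul, mul_comm, zpow_mul, zpow_natCast, hζ.pow_eq_one, one_zpow]
  rw [Finset.sum_congr rfl e2, ← Finset.sum_filter, Finset.sum_const, count_eq, nsmul_eq_mul,
    mul_comm]

lemma count_bound (a : ℤ) {c : ℕ} (hc : 1 < c) {ζ : ℂ} (hζ : IsPrimitiveRoot ζ c) (n : ℕ) :
    |(c : ℝ) * (oddBalancedCountMod a c n : ℝ) - vt n| ≤
      ∑ j ∈ Finset.Ico 1 c, ‖coeff n (VW (ζ ^ j) (n + 1))‖ := by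
  have hz0 : ζ ≠ 0 := hζ.ne_zero (by omega)
  have hza : ‖ζ ^ (-a)‖ = 1 := by
    rw [norm_zpow, hζ.norm'_eq_one (by omega), one_zpow]
  have h := count_sum a (by omega) hζ n
  rw [Finset.range_eq_Ico, Finset.sum_eq_sum_Ico_succ_bot (by omega)] at h
  have h0 : coeff n (VW (ζ ^ 0) (n + 1)) = ((vt n : ℝ) : ℂ) := by
    rw [← sum_rk (by simp), ← card_Om]
    simp
  rw [h0, pow_zero, one_mul, zero_add] at h
  have h' : (((c : ℝ) * (oddBalancedCountMod a c n : ℝ) - vt n : ℝ) : ℂ) =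
      ∑ j ∈ Finset.Ico 1 c, (ζ ^ (-a)) ^ j * coeff n (VW (ζ ^ j) (n + 1)) := by
    push_cast
    rw [h]
    ring
  rw [← Real.norm_eq_abs, ← Complex.norm_real, h']
  refine (norm_sum_le _ _).trans (Finset.sum_le_sum fun j _ => ?_)
  rw [norm_mul, norm_pow, hza, one_pow, one_mul]

lemma count_lim (a : ℤ) {c : ℕ} (hc : 1 < c) (hcodd : Odd c) :
    Tendsto (fun n : ℕ => (c : ℝ) * (oddBalancedCountMod a c n : ℝ) / ff n) atTop (𝓝 (1 / 2)) := by
  have hζ := Complex.isPrimitiveRoot_exp c (by omega)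
  set ζ := cexp (2 * π * I / c) with hdef
  have hs : Tendsto (fun n => ∑ j ∈ Finset.Ico 1 c, ‖coeff n (VW (ζ ^ j) (n + 1))‖ / ff n)
      atTop (𝓝 0) := by
    have := tendsto_finsetSum (Finset.Ico 1 c) (fun j hj =>
      VW_small (root_props hcodd hζ hj).1 (root_props hcodd hζ hj).2)
    simpa using this
  have hd : Tendsto (fun n => ((c : ℝ) * (oddBalancedCountMod a c n : ℝ) - vt n) / ff n)
      atTop (𝓝 0) := by
    refine squeeze_zero_norm' ?_ hs
    filter_upwards [ff_pos_ev] with n hn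
    rw [norm_div, Real.norm_eq_abs, Real.norm_eq_abs, abs_of_pos hn, ← Finset.sum_div]
    exact div_le_div_of_nonneg_right (count_bound a hc hζ n) hn.le
  have := hd.add vt_lim
  rw [zero_add] at this
  refine this.congr fun n => ?_
  ring

lemma quarter_eq (n : ℕ) : (n : ℝ) ^ ((1 : ℝ) / 4) = aa n := by
  unfold aa
  rw [Real.sqrt_eq_rpow, Real.sqrt_eq_rpow, ← Real.rpow_mul (Nat.cast_nonneg n)]
  norm_num

end OB

/-- Theorem 1.1 (second asymptotic): for odd `c > 1`,
`v(a,c;n) ~ (n^{1/4}/(2c)) · p̄(n)` as `n → ∞`. -/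
theorem oddBalancedCountMod_asymp_overpartition (a : ℤ) (c : ℕ) (hc : 1 < c) (hcodd : Odd c) :
    Tendsto (fun n : ℕ => (oddBalancedCountMod a c n : ℝ) /
      ((n : ℝ) ^ ((1 : ℝ) / 4) / (2 * c) * (overpartition n : ℝ)))
      atTop (nhds 1) := by
  have h := (OB.count_lim a hc hcodd).const_mul 2
  norm_num at h
  refine h.congr' ?_
  filter_upwards [OB.ff_pos_ev] with n hn
  have hc0 : (c : ℝ) ≠ 0 := by positivity
  rw [OB.quarter_eq, OB.overpartition_eq]
  unfold OB.ff at hn ⊢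
  have h1 : OB.aa n ≠ 0 := left_ne_zero_of_mul hn.ne'
  have h2 : OB.pb n ≠ 0 := right_ne_zero_of_mul hn.ne'
  field_simp
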